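/- For every integer r ≥ 0 and every natural number n, there exists a 3-connected cubic planar graph G with more than n vertices such that G has no cycle of length ℓ for any ℓ with 2r+6 ≤ ℓ ≤ 4r+14, and G has circumference at least 2r+6. Equivalently, setting k = 2r+6, for every even k ≥ 6 and every n there is a 3-connected cubic planar graph on more than n vertices of circumference at least k whose cycle spectrum avoids [k, 2k+2]. -/

import Mathlib

open SimpleGraph

/-- The cycle spectrum of a graph: the set of lengths of its cycles. -/
def CycleLengths {V : Type*} (G : SimpleGraph V) : Set ℕ :=
  {n | ∃ (v : V) (w : G.Walk v v), w.IsCycle ∧ w.length = n}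

/-- `G` has circumference at least `k`: some cycle has length at least `k`. -/
def CircumferenceAtLeast {V : Type*} (G : SimpleGraph V) (k : ℕ) : Prop :=
  ∃ n ∈ CycleLengths G, k ≤ n

/-- A graph is cubic if every vertex has exactly three neighbours. -/
def IsCubic {V : Type*} (G : SimpleGraph V) : Prop :=
  ∀ v : V, (G.neighborSet v).ncard = 3

/-- A graph is 3-connected if it has more than 3 vertices and deleting any set of
fewer than 3 vertices leaves it connected. -/
def IsThreeConnected {V : Type*} (G : SimpleGraph V) : Prop :=
  3 < (Set.univ : Set V).ncard ∧
    ∀ s : Set V, s.Finite → s.ncard < 3 → (G.induce (sᶜ : Set V)).Connected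

/-- Reversal of darts, as a permutation. -/
def dartReversal {V : Type*} (G : SimpleGraph V) : Equiv.Perm G.Dart :=
  Function.Involutive.toPerm SimpleGraph.Dart.symm Dart.symm_involutive

/-- A combinatorial embedding of `G` on an orientable surface, given by a rotation
system: a permutation of the darts preserving tails, acting transitively on the
darts at each vertex. -/
structure PlaneEmbedding {V : Type*} (G : SimpleGraph V) where
  rot : Equiv.Perm G.Dart
  rot_tail : ∀ d : G.Dart, (rot d).toProd.1 = d.toProd.1
  rot_orbit : ∀ d e : G.Dart, d.toProd.1 = e.toProd.1 → ∃ n : ℕ, (rot ^ n) d = e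

namespace PlaneEmbedding

variable {V : Type*} {G : SimpleGraph V}

/-- The face permutation of a combinatorial embedding. -/
def facePerm (E : PlaneEmbedding G) : Equiv.Perm G.Dart :=
  (dartReversal G).trans E.rot

/-- The face (orbit of the face permutation) containing a given dart. -/
def faceOf (E : PlaneEmbedding G) (d : G.Dart) : Set G.Dart :=
  {e | ∃ n : ℤ, (E.facePerm ^ n) d = e}

/-- The set of faces of a combinatorial embedding. -/
def faces (E : PlaneEmbedding G) : Set (Set G.Dart) :=
  {s | ∃ d : G.Dart, s = E.faceOf d}

/-- A combinatorial embedding is spherical (planar) when Euler's formula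
`|V| + |F| = |E| + 2` holds. -/
def IsSpherical (E : PlaneEmbedding G) : Prop :=
  (Set.univ : Set V).ncard + E.faces.ncard = G.edgeSet.ncard + 2

end PlaneEmbedding

/-- A graph is planar if it is connected and admits a spherical combinatorial
embedding (Heffter–Edmonds). -/
def IsPlanar {V : Type*} (G : SimpleGraph V) : Prop :=
  G.Connected ∧ ∃ E : PlaneEmbedding G, E.IsSpherical

/-- A cubic graph with a rotation system: the darts are the pairs `(v, i)` with `i : Fin 3`,
`(v, i + 1)` follows `(v, i)` in the rotation at `v`, and `flip` reverses darts. -/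
structure CubicMap (V : Type) where
  flip : V × Fin 3 → V × Fin 3
  flip_flip : ∀ d, flip (flip d) = d
  flip_ne : ∀ d, (flip d).1 ≠ d.1
  flip_inj : ∀ v i j, (flip (v, i)).1 = (flip (v, j)).1 → i = j

namespace CubicMap

variable {V : Type}

/-- The rotation of a cubic map. -/
def rotation (V : Type) : Equiv.Perm (V × Fin 3) :=
  Equiv.prodCongr (Equiv.refl V) (Equiv.addRight 1)

/-- The face permutation of a cubic map. -/
def facePerm (M : CubicMap V) : Equiv.Perm (V × Fin 3) :=
  (Function.Involutive.toPerm M.flip M.flip_flip).trans (rotation V)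

theorem facePerm_apply (M : CubicMap V) (d : V × Fin 3) :
    M.facePerm d = ((M.flip d).1, (M.flip d).2 + 1) := rfl

/-- The number of faces is the one prescribed by Euler's formula for the sphere. -/
def Spherical (M : CubicMap V) : Prop :=
  ∃ (L : Type) (_ : Finite L) (label : V × Fin 3 → L), Function.Surjective label ∧
    (∀ d, label (M.facePerm d) = label d) ∧
    (∀ d e, label d = label e → M.facePerm.SameCycle d e) ∧
    2 * Nat.card L = Nat.card V + 4

/-- No two vertices separate the map: a predicate which is constant along all edges avoiding
`x` and `y` is constant on the complement of `{x, y}`. -/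
def ThreeConnected (M : CubicMap V) : Prop :=
  ∀ (x y : V) (P : V → Prop),
    (∀ d, d.1 ≠ x → d.1 ≠ y → (M.flip d).1 ≠ x → (M.flip d).1 ≠ y → (P d.1 ↔ P (M.flip d).1)) →
    ∀ u w, u ≠ x → u ≠ y → w ≠ x → w ≠ y → (P u ↔ P w)

/-- A set of darts that consists of both darts of each edge of an even subgraph. -/
def IsEven (M : CubicMap V) (S : V × Fin 3 → Bool) : Prop :=
  (∀ d, S (M.flip d) = S d) ∧ ∀ v, (S (v, 0) ^^ S (v, 1) ^^ S (v, 2)) = false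

section Truncation

/-- The vertices after replacing `v` by a triangle. -/
abbrev TruncVertex (v : V) : Type := {u : V // u ≠ v} ⊕ Fin 3

/-- The vertex of the original map that a vertex of the truncation comes from. -/
def truncProj (v : V) : TruncVertex v → V
  | Sum.inl u => u
  | Sum.inr _ => v

open Classical in
/-- The dart of the truncation corresponding to a dart of the original map. -/
noncomputable def truncLift (v : V) (d : V × Fin 3) : TruncVertex v × Fin 3 :=
  if h : d.1 = v then (Sum.inr d.2, d.2) else (Sum.inl ⟨d.1, h⟩, d.2)

/-- The reversal of darts after replacing `v` by a triangle. -/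
noncomputable def truncFlip (M : CubicMap V) (v : V) :
    TruncVertex v × Fin 3 → TruncVertex v × Fin 3
  | (Sum.inl u, k) => truncLift v (M.flip (u, k))
  | (Sum.inr i, j) => if i = j then truncLift v (M.flip (v, i)) else (Sum.inr j, i)

variable (M : CubicMap V) (v : V)

theorem truncLift_self (k : Fin 3) : truncLift v (v, k) = (Sum.inr k, k) := by
  simp [truncLift]

theorem truncLift_of_ne (u : {u : V // u ≠ v}) (k : Fin 3) :
    truncLift v (u.1, k) = (Sum.inl u, k) := by
  simp [truncLift, u.2]

theorem truncLift_snd (d : V × Fin 3) : (truncLift v d).2 = d.2 := by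
  unfold truncLift; split <;> rfl

theorem truncProj_truncLift (d : V × Fin 3) : truncProj v (truncLift v d).1 = d.1 := by
  unfold truncLift; split
  · rename_i h; exact h.symm
  · rfl

theorem truncFlip_truncLift (d : V × Fin 3) :
    M.truncFlip v (truncLift v d) = truncLift v (M.flip d) := by
  obtain ⟨u, k⟩ := d
  by_cases h : u = v
  · subst h; simp [truncLift_self, truncFlip]
  · rw [truncLift_of_ne v ⟨u, h⟩]; simp [truncFlip]

theorem truncFlip_inner {i j : Fin 3} (h : i ≠ j) :
    M.truncFlip v (Sum.inr i, j) = (Sum.inr j, i) := by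
  simp [truncFlip, h]

theorem trunc_cases (d : TruncVertex v × Fin 3) :
    (∃ e, d = truncLift v e) ∨ ∃ i j, i ≠ j ∧ d = (Sum.inr i, j) := by
  obtain ⟨u | i, k⟩ := d
  · exact Or.inl ⟨(u.1, k), (truncLift_of_ne v u k).symm⟩
  · by_cases h : i = k
    · subst h; exact Or.inl ⟨(v, i), (truncLift_self v i).symm⟩
    · exact Or.inr ⟨i, k, h, rfl⟩

theorem truncLift_fst_eq {d e : V × Fin 3} (h : (truncLift v d).1 = (truncLift v e).1) :
    d.1 = e.1 := by
  rw [← truncProj_truncLift v d, h, truncProj_truncLift]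

/-- The cubic map obtained by replacing the vertex `v` by a triangle. -/
noncomputable def truncate : CubicMap (TruncVertex v) where
  flip := M.truncFlip v
  flip_flip d := by
    obtain ⟨e, rfl⟩ | ⟨i, j, h, rfl⟩ := trunc_cases v d
    · rw [truncFlip_truncLift, truncFlip_truncLift, M.flip_flip]
    · rw [truncFlip_inner M v h, truncFlip_inner M v h.symm]
  flip_ne d := by
    obtain ⟨e, rfl⟩ | ⟨i, j, h, rfl⟩ := trunc_cases v d
    · rw [truncFlip_truncLift]
      exact fun h => M.flip_ne e (truncLift_fst_eq v h)
    · rw [truncFlip_inner M v h]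
      simpa using h.symm
  flip_inj u i j h := by
    obtain u | k := u
    · rw [← truncLift_of_ne, ← truncLift_of_ne, truncFlip_truncLift, truncFlip_truncLift] at h
      exact M.flip_inj _ _ _ (truncLift_fst_eq v h)
    · have key : ∀ a b : Fin 3, a ≠ k →
          (M.truncFlip v (Sum.inr k, a)).1 = (M.truncFlip v (Sum.inr k, b)).1 → a = b := by
        intro a b ha hab
        rw [truncFlip_inner M v ha.symm] at hab
        by_cases hb : b = k
        · subst hb
          rw [← truncLift_self, truncFlip_truncLift] at hab
          have := congrArg (truncProj v) hab
          rw [truncProj_truncLift] at this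
          exact absurd this.symm (M.flip_ne (v, b))
        · rw [truncFlip_inner M v (Ne.symm hb)] at hab
          simpa using hab
      by_cases hi : i = k
      · by_cases hj : j = k
        · rw [hi, hj]
        · exact (key j i hj h.symm).symm
      · exact key i j hi h

theorem truncate_flip_truncLift (d : V × Fin 3) :
    (M.truncate v).flip (truncLift v d) = truncLift v (M.flip d) := M.truncFlip_truncLift v d

theorem truncate_flip_inner {i j : Fin 3} (h : i ≠ j) :
    (M.truncate v).flip (Sum.inr i, j) = (Sum.inr j, i) := M.truncFlip_inner v h

variable {M}

theorem ThreeConnected.truncate (hM : M.ThreeConnected) : (M.truncate v).ThreeConnected := by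
  have triangle_removed : ∀ (k : Fin 3) (y : TruncVertex v) (P : TruncVertex v → Prop),
      (∀ d, d.1 ≠ Sum.inr k → d.1 ≠ y → ((M.truncate v).flip d).1 ≠ Sum.inr k →
        ((M.truncate v).flip d).1 ≠ y → (P d.1 ↔ P ((M.truncate v).flip d).1)) →
      ∀ u w, u ≠ Sum.inr k → u ≠ y → w ≠ Sum.inr k → w ≠ y → (P u ↔ P w) := by
    intro k y P hP
    have outer : ∀ a b : {u : V // u ≠ v}, Sum.inl a ≠ y → Sum.inl b ≠ y →
        (P (Sum.inl a) ↔ P (Sum.inl b)) := by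
      intro a b ha hb
      have hne : ∀ a : {u : V // u ≠ v}, Sum.inl a ≠ y → a.1 ≠ truncProj v y := by
        rintro a ha h
        obtain y | y := y
        · exact ha (congrArg Sum.inl (Subtype.ext h))
        · exact a.2 h
      have := hM v (truncProj v y) (fun u => ∃ h : u ≠ v, P (Sum.inl ⟨u, h⟩)) ?_ a.1 b.1
        a.2 (hne a ha) b.2 (hne b hb)
      · simpa [a.2, b.2] using this
      · rintro ⟨u, i⟩ h1 h2 h3 h4
        dsimp only at h1 h2
        have e1 := truncLift_of_ne v ⟨u, h1⟩ i
        have e2 := truncLift_of_ne v ⟨_, h3⟩ (M.flip (u, i)).2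
        have e3 := truncate_flip_truncLift M v (u, i)
        have hy : ∀ (a : V) (ha : a ≠ v), a ≠ truncProj v y → Sum.inl ⟨a, ha⟩ ≠ y := by
          rintro a ha h rfl
          exact h rfl
        have := hP (truncLift v (u, i))
        rw [e3, e1] at this
        erw [e2] at this
        have := this (by simp) (hy _ _ h2) (by simp) (hy _ _ h4)
        simp only [h1, h3, ne_eq, not_false_eq_true, exists_true_left]
        exact this
    have attach : ∀ i : Fin 3, i ≠ k → Sum.inr i ≠ y →
        Sum.inl ⟨(M.flip (v, i)).1, M.flip_ne (v, i)⟩ ≠ y →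
        (P (Sum.inr i) ↔ P (Sum.inl ⟨(M.flip (v, i)).1, M.flip_ne (v, i)⟩)) := by
      intro i hi hiy hy
      have := hP (Sum.inr i, i)
      rw [← truncLift_self, truncate_flip_truncLift, truncLift_self] at this
      have e2 := truncLift_of_ne v ⟨_, M.flip_ne (v, i)⟩ (M.flip (v, i)).2
      erw [e2] at this
      exact this (by simpa using hi) hiy (by simp) hy
    have reach : ∀ u, u ≠ Sum.inr k → u ≠ y →
        ∃ a : {u : V // u ≠ v}, Sum.inl a ≠ y ∧ (P u ↔ P (Sum.inl a)) := by
      rintro (u | i) h1 h2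
      · exact ⟨u, h2, Iff.rfl⟩
      · have hik : i ≠ k := by simpa using h1
        by_cases hy : Sum.inl ⟨(M.flip (v, i)).1, M.flip_ne (v, i)⟩ = y
        · obtain ⟨j, hji, hjk⟩ : ∃ j : Fin 3, j ≠ i ∧ j ≠ k :=
            (by decide : ∀ i k : Fin 3, ∃ j, j ≠ i ∧ j ≠ k) i k
          have hjy : (Sum.inr j : TruncVertex v) ≠ y := by rw [← hy]; simp
          have hj : Sum.inl ⟨(M.flip (v, j)).1, M.flip_ne (v, j)⟩ ≠ y := by
            rw [← hy]
            intro h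
            simp only [Sum.inl.injEq, Subtype.mk.injEq] at h
            exact hji (M.flip_inj v j i h)
          refine ⟨_, hj, Iff.trans ?_ (attach j hjk hjy hj)⟩
          have := hP (Sum.inr i, j)
          rw [truncate_flip_inner M v hji.symm] at this
          exact this h1 h2 (by simpa using hjk) hjy
        · exact ⟨_, hy, attach i hik h2 hy⟩
    intro u w hu hu' hw hw'
    obtain ⟨a, ha, hPa⟩ := reach u hu hu'
    obtain ⟨b, hb, hPb⟩ := reach w hw hw'
    exact hPa.trans ((outer a b ha hb).trans hPb.symm)
  rintro (x | x) y P hP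
  · obtain y | y := y
    · have tri : ∀ i j : Fin 3, P (Sum.inr i) ↔ P (Sum.inr j) := by
        intro i j
        by_cases h : i = j
        · rw [h]
        · have := hP (Sum.inr i, j)
          rw [truncate_flip_inner M v h] at this
          exact this (by simp) (by simp) (by simp) (by simp)
      let Q : V → Prop := fun u => ∃ z, truncProj v z = u ∧ P z
      have hQ : ∀ z, Q (truncProj v z) ↔ P z := by
        intro z
        refine ⟨?_, fun h => ⟨z, rfl, h⟩⟩
        rintro ⟨z', h, hz'⟩
        obtain z | z := z <;> obtain z' | z' := z'
        · have : z' = z := Subtype.ext h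
          rwa [← this]
        · exact absurd h.symm z.2
        · exact absurd h z'.2
        · exact (tri _ _).1 hz'
      have hne : ∀ (z : TruncVertex v) (a : {u : V // u ≠ v}), z ≠ Sum.inl a →
          truncProj v z ≠ a.1 := by
        rintro (z | z) a h h'
        · exact h (congrArg Sum.inl (Subtype.ext h'))
        · exact a.2 h'.symm
      have hne' : ∀ (z : TruncVertex v) (a : {u : V // u ≠ v}), truncProj v z ≠ a.1 →
          z ≠ Sum.inl a := by
        rintro _ a h rfl; exact h rfl
      intro u w h1 h2 h3 h4
      rw [← hQ, ← hQ w]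
      refine hM x.1 y.1 Q ?_ _ _ (hne _ _ h1) (hne _ _ h2) (hne _ _ h3) (hne _ _ h4)
      intro d g1 g2 g3 g4
      have := hP (truncLift v d)
      rw [truncate_flip_truncLift] at this
      rw [← truncProj_truncLift v d, ← truncProj_truncLift v (M.flip d), hQ, hQ]
      rw [← truncProj_truncLift v] at g1 g2 g3 g4
      exact this (hne' _ _ g1) (hne' _ _ g2) (hne' _ _ g3) (hne' _ _ g4)
    · intro u w h1 h2 h3 h4
      exact triangle_removed y (Sum.inl x) P (fun d a b c e => hP d b a e c) u w h2 h1 h4 h3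
  · exact triangle_removed x y P hP

theorem Spherical.truncate [Finite V] (hM : M.Spherical) : (M.truncate v).Spherical := by
  obtain ⟨L, _, label, hsurj, hinv, hsame, hcard⟩ := hM
  have h12 : ∀ k : Fin 3, k + 1 + 1 ≠ k := by decide
  have h01 : ∀ k : Fin 3, k ≠ k + 1 := by decide
  have cases3 : ∀ i j : Fin 3, i ≠ j → j = i + 1 ∨ i = j + 1 := by decide
  have face_inner : ∀ i j : Fin 3, i ≠ j →
      (M.truncate v).facePerm (Sum.inr i, j) = (Sum.inr j, i + 1) := by
    intro i j h
    rw [facePerm_apply, truncate_flip_inner M v h]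
  have face_lift : ∀ d, (M.truncate v).facePerm (truncLift v d) =
      ((truncLift v (M.flip d)).1, (M.flip d).2 + 1) := by
    intro d
    rw [facePerm_apply, truncate_flip_truncLift, truncLift_snd]
  have face_lift_ne : ∀ d, (M.flip d).1 ≠ v →
      (M.truncate v).facePerm (truncLift v d) = truncLift v (M.facePerm d) := by
    intro d h
    rw [face_lift, facePerm_apply]
    simp [truncLift, h]
  have face_lift_eq : ∀ d k, M.flip d = (v, k) →
      (M.truncate v).facePerm (truncLift v d) = (Sum.inr k, k + 1) := by
    intro d k h
    rw [face_lift, h, truncLift_self]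
  have same_lift : ∀ d e, M.facePerm.SameCycle d e →
      (M.truncate v).facePerm.SameCycle (truncLift v d) (truncLift v e) := by
    have step : ∀ d, (M.truncate v).facePerm.SameCycle (truncLift v d)
        (truncLift v (M.facePerm d)) := by
      intro d
      have step1 : (M.truncate v).facePerm.SameCycle (truncLift v d)
          ((M.truncate v).facePerm (truncLift v d)) :=
        Equiv.Perm.sameCycle_apply_right.2 (.refl _ _)
      by_cases h : (M.flip d).1 = v
      · obtain ⟨k, hk⟩ : ∃ k, M.flip d = (v, k) := ⟨(M.flip d).2, by rw [← h]⟩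
        have e1 := face_lift_eq d k hk
        have e2 := face_inner k (k + 1) (h01 k)
        rw [← truncLift_self, ← e1] at e2
        rw [facePerm_apply, hk, ← e2]
        exact step1.trans (Equiv.Perm.sameCycle_apply_right.2 (.refl _ _))
      · rw [← face_lift_ne d h]
        exact step1
    rintro d e ⟨n, rfl⟩
    induction n using Int.induction_on with
    | zero => exact Equiv.Perm.SameCycle.refl _ _
    | succ n ih =>
      rw [add_comm, zpow_add, zpow_one, Equiv.Perm.mul_apply]
      exact ih.trans (step _)
    | pred n ih =>
      refine ih.trans (Equiv.Perm.SameCycle.symm ?_)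
      have := step ((M.facePerm ^ (-(n : ℤ) - 1)) d)
      rwa [← Equiv.Perm.mul_apply, ← zpow_one_add, add_sub_cancel] at this
  let label' : TruncVertex v × Fin 3 → Option L
    | (Sum.inl u, k) => some (label (u, k))
    | (Sum.inr i, j) => if i = j then some (label (v, i)) else
        if j = i + 1 then some (label (v, j)) else none
  have label_lift : ∀ d, label' (truncLift v d) = some (label d) := by
    rintro ⟨u, k⟩
    by_cases h : u = v
    · subst h; simp [truncLift_self, label']
    · rw [truncLift_of_ne v ⟨u, h⟩]
  have label_succ : ∀ k : Fin 3, label' (Sum.inr k, k + 1) = some (label (v, k + 1)) := by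
    intro k; simp [label']
  have label_none : ∀ k : Fin 3, label' (Sum.inr (k + 1), k) = none := by
    intro k; simp [label', (h12 k).symm]
  refine ⟨Option L, inferInstance, label', ?_, ?_, ?_, ?_⟩
  · rintro (_ | l)
    · exact ⟨(Sum.inr (0 + 1), 0), label_none 0⟩
    · obtain ⟨d, rfl⟩ := hsurj l
      exact ⟨_, label_lift d⟩
  · intro d
    obtain ⟨e, rfl⟩ | ⟨i, j, h, rfl⟩ := trunc_cases v d
    · by_cases h : (M.flip e).1 = v
      · obtain ⟨k, hk⟩ : ∃ k, M.flip e = (v, k) := ⟨(M.flip e).2, by rw [← h]⟩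
        rw [face_lift_eq e k hk, label_succ, label_lift, ← hinv e, facePerm_apply, hk]
      · rw [face_lift_ne e h, label_lift, label_lift, hinv]
    · rw [face_inner i j h]
      obtain rfl | rfl := cases3 i j h
      · rw [← truncLift_self, label_lift, label_succ]
      · rw [label_none]
        have : j + 1 + 1 + 1 = j := by revert j; decide
        have := label_none (j + 1 + 1)
        rwa [‹j + 1 + 1 + 1 = j›] at this
  · have rep : ∀ d l, label' d = some l → ∃ e, label e = l ∧
        (M.truncate v).facePerm.SameCycle d (truncLift v e) := by
      intro d l hl
      obtain ⟨e, rfl⟩ | ⟨i, j, h, rfl⟩ := trunc_cases v d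
      · rw [label_lift] at hl
        exact ⟨e, Option.some.inj hl, Equiv.Perm.SameCycle.refl _ _⟩
      · obtain rfl | rfl := cases3 i j h
        · rw [label_succ] at hl
          refine ⟨_, Option.some.inj hl, ?_⟩
          rw [truncLift_self, ← face_inner i (i + 1) h]
          exact Equiv.Perm.sameCycle_apply_right.2 (.refl _ _)
        · rw [label_none] at hl; cases hl
    have rep_none : ∀ d, label' d = none →
        (M.truncate v).facePerm.SameCycle d (Sum.inr 1, 0) := by
      intro d hd
      obtain ⟨e, rfl⟩ | ⟨i, j, h, rfl⟩ := trunc_cases v d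
      · rw [label_lift] at hd; cases hd
      · obtain rfl | rfl := cases3 i j h
        · rw [label_succ] at hd; cases hd
        · have e0 := face_inner 1 0 (by decide)
          have e1 := face_inner 0 2 (by decide)
          fin_cases j
          · exact Equiv.Perm.SameCycle.refl _ _
          · refine Equiv.Perm.SameCycle.symm ⟨2, ?_⟩
            change (M.truncate v).facePerm ((M.truncate v).facePerm (Sum.inr 1, 0)) = _
            rw [e0]; exact e1
          · refine Equiv.Perm.SameCycle.symm ⟨1, ?_⟩
            rw [zpow_one, e0]; rfl
    intro d e hde
    cases hl : label' d with
    | none => exact (rep_none d hl).trans (rep_none e (hde ▸ hl)).symm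
    | some l =>
      obtain ⟨a, ha, hda⟩ := rep d l hl
      obtain ⟨b, hb, heb⟩ := rep e l (hde ▸ hl)
      exact hda.trans ((same_lift a b (hsame a b (ha.trans hb.symm))).trans heb.symm)
  · have : Nat.card (TruncVertex v) = Nat.card V + 2 := by
      classical
      have := Fintype.ofFinite V
      simp only [Nat.card_eq_fintype_card, Fintype.card_sum, Fintype.card_fin,
        Fintype.card_subtype_compl, Fintype.card_subtype_eq]
      have : 0 < Fintype.card V := Fintype.card_pos_iff.2 ⟨v⟩
      omega
    rw [this, Finite.card_option]
    omega

end Truncation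

end CubicMap

namespace CubicMap

open scoped Classical in
/-- A weighted cubic map over a set `H` of clusters. The cost of a dart `(u, k)` is
`1 + f u + 2 * p u k`; even subgraphs leaving a cluster have cost at least `8 * r + 30`, and the
map can be expanded, by replacing vertices by triangles, to one in which all darts have cost `1`
and all clusters have at most `2 * r + 5` vertices. -/
structure Expandable (r : ℕ) {V H : Type} [Fintype V] (M : CubicMap V) (π : V → H) (f : V → ℕ)
    (p : V → Fin 3 → ℕ) : Prop where
  threeConnected : M.ThreeConnected
  spherical : M.Spherical
  exists_crossing : ∃ d, π (M.flip d).1 ≠ π d.1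
  cluster_le : ∀ h, ∑ u, (if π u = h then 1 + 2 * (f u + ∑ k, p u k) else 0) ≤ 2 * r + 5
  le_cost : ∀ S, M.IsEven S → (∃ d, S d = true ∧ π (M.flip d).1 ≠ π d.1) →
    8 * r + 30 ≤ ∑ u, ∑ k, (if S (u, k) = true then 1 + f u + 2 * p u k else 0)
  f_le : ∀ u, f u ≤ 1

section

variable {V H : Type} [Fintype V]

open scoped Classical in
noncomputable instance (v : V) : Fintype (TruncVertex v) :=
  inferInstanceAs (Fintype ({u : V // u ≠ v} ⊕ Fin 3))

theorem sum_truncVertex (v : V) (g : TruncVertex v → ℕ) (g' : V → ℕ)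
    (hg : ∀ u : {u : V // u ≠ v}, g (Sum.inl u) = g' u) :
    ∑ z, g z + g' v = ∑ u, g' u + ∑ k, g (Sum.inr k) := by
  classical
  rw [show ∑ z, g z = _ from Fintype.sum_sum_type g, ← Fintype.sum_subtype_add_sum_subtype (fun u => u ≠ v) g',
    Finset.sum_congr rfl fun u _ => hg u]
  have : ∑ u : {u : V // ¬ u ≠ v}, g' u = g' v := by
    have : Unique {u : V // ¬ u ≠ v} :=
      { default := ⟨v, by simp⟩, uniq := fun a => Subtype.ext (not_not.1 a.2) }
    rw [Fintype.sum_unique]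
    exact congrArg g' (not_not.1 (default : {u : V // ¬ u ≠ v}).2)
  rw [this]
  ring

/-- The weights after replacing `v` by a triangle whose corners carry `q` on their outer darts. -/
def truncWeight (v : V) (p : V → Fin 3 → ℕ) (q : Fin 3 → ℕ) : TruncVertex v → Fin 3 → ℕ
  | Sum.inl u, k => p u k
  | Sum.inr i, k => if i = k then q i else 0

/-- The flags after replacing `v` by a triangle. -/
def truncFlag (v : V) (f : V → ℕ) : TruncVertex v → ℕ
  | Sum.inl u => f u
  | Sum.inr _ => 0

theorem triangle_cost_le (a b c x y z : Bool) (f p₀ p₁ p₂ q₀ q₁ q₂ : ℕ)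
    (ha : (a ^^ x ^^ y) = false) (hb : (x ^^ b ^^ z) = false) (hc : (y ^^ z ^^ c) = false)
    (h01 : f + p₀ + p₁ ≤ q₀ + q₁ + 1) (h02 : f + p₀ + p₂ ≤ q₀ + q₂ + 1)
    (h12 : f + p₁ + p₂ ≤ q₁ + q₂ + 1) :
    (if a = true then 1 + f + 2 * p₀ else 0) + (if b = true then 1 + f + 2 * p₁ else 0) +
      (if c = true then 1 + f + 2 * p₂ else 0) ≤
    ((if a = true then 1 + 2 * q₀ else 0) + (if x = true then 1 else 0) +
      (if y = true then 1 else 0)) +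
    ((if x = true then 1 else 0) + (if b = true then 1 + 2 * q₁ else 0) +
      (if z = true then 1 else 0)) +
    ((if y = true then 1 else 0) + (if z = true then 1 else 0) +
      (if c = true then 1 + 2 * q₂ else 0)) := by
  cases x <;> cases y <;> cases z <;> simp at ha hb hc <;> subst ha hb hc <;> simp <;> omega

open scoped Classical in
theorem Expandable.truncate {r : ℕ} {M : CubicMap V} {π : V → H} {f : V → ℕ} {p : V → Fin 3 → ℕ}
    (h : Expandable r M π f p) (v : V) (q : Fin 3 → ℕ)
    (hq : f v + ∑ k, p v k = 1 + ∑ k, q k)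
    (hpair : ∀ i j : Fin 3, i ≠ j → f v + p v i + p v j ≤ q i + q j + 1) :
    Expandable r (M.truncate v) (π ∘ truncProj v) (truncFlag v f) (truncWeight v p q) where
  threeConnected := h.threeConnected.truncate v
  spherical := h.spherical.truncate v
  exists_crossing := by
    obtain ⟨d, hd⟩ := h.exists_crossing
    refine ⟨truncLift v d, ?_⟩
    simpa [truncate_flip_truncLift, truncProj_truncLift] using hd
  cluster_le a := by
    refine le_trans (le_of_eq ?_) (h.cluster_le a)
    have := sum_truncVertex v
      (fun z => if (π ∘ truncProj v) z = a then
        1 + 2 * (truncFlag v f z + ∑ k, truncWeight v p q z k) else 0)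
      (fun u => if π u = a then 1 + 2 * (f u + ∑ k, p u k) else 0)
      (fun _ => rfl)
    have key : ∑ k : Fin 3, (if (π ∘ truncProj v) (Sum.inr k) = a then
        1 + 2 * (truncFlag v f (Sum.inr k) + ∑ j, truncWeight v p q (Sum.inr k) j) else 0) =
        (if π v = a then 1 + 2 * (f v + ∑ k, p v k) else 0) := by
      by_cases hv : π v = a
      · simp only [Function.comp_apply, truncProj, hv, if_true, truncFlag, truncWeight, hq]
        simp [Fin.sum_univ_three]
        ring
      · simp [truncProj, hv]
    convert Nat.add_right_cancel (this.trans (by rw [key])) using 2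
  le_cost S hS hcross := by
    obtain ⟨hflip, hpar⟩ := hS
    have inner : ∀ i j : Fin 3, i ≠ j → S (Sum.inr i, j) = S (Sum.inr j, i) := by
      intro i j hij
      rw [← hflip, truncate_flip_inner M v hij]
    have e01 := inner 0 1 (by decide)
    have e02 := inner 0 2 (by decide)
    have e12 := inner 1 2 (by decide)
    have p0 := hpar (Sum.inr 0)
    have p1 := hpar (Sum.inr 1)
    have p2 := hpar (Sum.inr 2)
    have hT := h.le_cost (fun d => S (truncLift v d)) ⟨?_, ?_⟩ ?_
    · refine hT.trans ?_
      have := sum_truncVertex v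
        (fun z => ∑ k, (if S (z, k) = true then
          1 + truncFlag v f z + 2 * truncWeight v p q z k else 0))
        (fun u => ∑ k, (if S (truncLift v (u, k)) = true then 1 + f u + 2 * p u k else 0))
        (fun u => by simp only [truncLift_of_ne]; rfl)
      have key : ∑ k, (if S (truncLift v (v, k)) = true then 1 + f v + 2 * p v k else 0) ≤
          ∑ i : Fin 3, ∑ k, (if S (Sum.inr i, k) = true then
            1 + truncFlag v f (Sum.inr i) + 2 * truncWeight v p q (Sum.inr i) k else 0) := by
        rw [← e01] at p1
        rw [← e02, ← e12] at p2
        have := triangle_cost_le _ _ _ _ _ _ (f v) (p v 0) (p v 1) (p v 2) (q 0) (q 1) (q 2)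
          p0 p1 p2 (by simpa using hpair 0 1 (by decide)) (by simpa using hpair 0 2 (by decide))
          (by simpa using hpair 1 2 (by decide))
        simpa [truncLift_self, Fin.sum_univ_three, truncFlag, truncWeight, ← e01, ← e02, ← e12]
          using this
      omega
    · intro d
      simp only [← truncate_flip_truncLift, hflip]
    · intro u
      by_cases hu : u = v
      · subst hu
        simp only [truncLift_self]
        rw [← e01] at p1
        rw [← e02, ← e12] at p2
        generalize S (Sum.inr 0, 0) = a at *
        generalize S (Sum.inr 1, 1) = b at *
        generalize S (Sum.inr 2, 2) = c at *
        generalize S (Sum.inr 0, 1) = x at *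
        generalize S (Sum.inr 0, 2) = y at *
        generalize S (Sum.inr 1, 2) = z at *
        revert p0 p1 p2
        clear * -
        revert a b c x y z
        decide
      · have := hpar (Sum.inl ⟨u, hu⟩)
        simpa only [← truncLift_of_ne] using this
    · obtain ⟨d, hd, hne⟩ := hcross
      obtain ⟨e, rfl⟩ | ⟨i, j, hij, rfl⟩ := trunc_cases v d
      · refine ⟨e, hd, ?_⟩
        simpa [truncate_flip_truncLift, truncProj_truncLift] using hne
      · rw [truncate_flip_inner M v hij] at hne
        exact absurd rfl hne
  f_le u := by
    obtain u | k := u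
    · exact h.f_le u
    · exact Nat.zero_le _

theorem Expandable.exists_truncate {r : ℕ} {M : CubicMap V} {π : V → H} {f : V → ℕ}
    {p : V → Fin 3 → ℕ} (h : Expandable r M π f p) (v : V) (hv : f v + ∑ k, p v k ≠ 0) :
    ∃ q : Fin 3 → ℕ, f v + ∑ k, p v k = 1 + ∑ k, q k ∧
      Expandable r (M.truncate v) (π ∘ truncProj v) (truncFlag v f) (truncWeight v p q) := by
  obtain hf | hf : f v = 1 ∨ f v = 0 := by have := h.f_le v; omega
  · exact ⟨p v, by rw [hf], h.truncate v (p v) (by rw [hf]) (fun i j _ => by omega)⟩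
  · obtain ⟨i, hi⟩ : ∃ i, p v i ≠ 0 := by
      by_contra! hp
      simp [hf, hp] at hv
    have hsum : f v + ∑ k, p v k = 1 + ∑ k, Function.update (p v) i (p v i - 1) k := by
      have e : ∑ k ∈ Finset.univ.erase i, Function.update (p v) i (p v i - 1) k =
          ∑ k ∈ Finset.univ.erase i, p v k :=
        Finset.sum_congr rfl fun k hk => Function.update_of_ne (Finset.ne_of_mem_erase hk) _ _
      have h1 := Finset.add_sum_erase Finset.univ (p v) (Finset.mem_univ i)
      have h2 := Finset.add_sum_erase Finset.univ (fun k => Function.update (p v) i (p v i - 1) k)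
        (Finset.mem_univ i)
      rw [Function.update_self] at h2
      omega
    refine ⟨_, hsum, h.truncate v _ hsum fun a b hab => ?_⟩
    rw [hf]
    by_cases ha : a = i
    · subst ha
      rw [Function.update_self, Function.update_of_ne hab.symm]
      omega
    · by_cases hb : b = i
      · subst hb
        rw [Function.update_self, Function.update_of_ne ha]
        omega
      · rw [Function.update_of_ne ha, Function.update_of_ne hb]
        omega

end

/-- The data of `Expandable` after all expansions have been carried out. -/
theorem Expandable.exists_expanded {r : ℕ} {H : Type} (t : ℕ) :
    ∀ {V : Type} [Fintype V] {M : CubicMap V} {π : V → H} {f : V → ℕ} {p : V → Fin 3 → ℕ},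
      Expandable r M π f p → ∑ u, (f u + ∑ k, p u k) = t →
      ∃ (W : Type) (_ : Fintype W) (N : CubicMap W) (ρ : W → H),
        Fintype.card V ≤ Fintype.card W ∧ Expandable r N ρ (fun _ => 0) (fun _ _ => 0) := by
  induction t with
  | zero =>
    intro V _ M π f p h ht
    have h0 : ∀ u, f u = 0 ∧ ∀ k, p u k = 0 := by
      intro u
      have := Finset.sum_eq_zero_iff.1 ht u (Finset.mem_univ u)
      have h2 : ∑ k, p u k = 0 := by omega
      exact ⟨by omega, fun k => Finset.sum_eq_zero_iff.1 h2 k (Finset.mem_univ k)⟩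
    have hf : f = fun _ => 0 := funext fun u => (h0 u).1
    have hp : p = fun _ _ => 0 := funext fun u => funext (h0 u).2
    subst hf hp
    exact ⟨V, inferInstance, M, π, le_rfl, h⟩
  | succ t ih =>
    intro V _ M π f p h ht
    classical
    obtain ⟨v, -, hv⟩ := Finset.exists_ne_zero_of_sum_ne_zero (by rw [ht]; omega :
      ∑ u, (f u + ∑ k, p u k) ≠ 0)
    obtain ⟨q, hq, h'⟩ := h.exists_truncate v hv
    have hsum := sum_truncVertex v
      (fun z => truncFlag v f z + ∑ k, truncWeight v p q z k)
      (fun u => f u + ∑ k, p u k) (fun u => rfl)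
    have hcard := sum_truncVertex v (fun _ => 1) (fun _ => 1) (fun u => rfl)
    have htri : ∑ i : Fin 3, (truncFlag v f (Sum.inr i) + ∑ k, truncWeight v p q (Sum.inr i) k) =
        ∑ k, q k := by
      simp [truncFlag, truncWeight]
    simp only [Finset.sum_const, Finset.card_univ, Fintype.card_fin, smul_eq_mul, mul_one] at hcard
    obtain ⟨W, iW, N, ρ, hWcard, hN⟩ := ih h' (by omega)
    exact ⟨W, iW, N, ρ, by omega, hN⟩

end CubicMap

namespace CubicMap

/-- Transport of a cubic map along a bijection of the vertices. -/
def congr {V W : Type} (M : CubicMap V) (e : V ≃ W) : CubicMap W where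
  flip d := (e (M.flip (e.symm d.1, d.2)).1, (M.flip (e.symm d.1, d.2)).2)
  flip_flip d := by simp [M.flip_flip]
  flip_ne d h := M.flip_ne (e.symm d.1, d.2) (by simpa using congrArg e.symm h)
  flip_inj v i j h := M.flip_inj _ i j (e.injective h)

open scoped Classical in
theorem Expandable.congr {r : ℕ} {V W H : Type} [Fintype V] [Fintype W] {M : CubicMap V} {π : V → H}
    {f : V → ℕ} {p : V → Fin 3 → ℕ} (h : Expandable r M π f p) (e : V ≃ W) :
    Expandable r (M.congr e) (π ∘ e.symm) (f ∘ e.symm) (p ∘ e.symm) where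
  threeConnected x y P hP u w h1 h2 h3 h4 := by
    have := h.threeConnected (e.symm x) (e.symm y) (P ∘ e) ?_ (e.symm u) (e.symm w)
      (by simpa) (by simpa) (by simpa) (by simpa)
    · simpa using this
    · intro d g1 g2 g3 g4
      have := hP (e d.1, d.2)
      simp only [CubicMap.congr, e.symm_apply_apply, Prod.mk.eta] at this
      rw [e.eq_symm_apply.ne] at g1 g2 g3 g4
      exact this g1 g2 g3 g4
  spherical := by
    obtain ⟨L, hL, label, h1, h2, h3, h4⟩ := h.spherical
    have hface : ∀ d, (M.congr e).facePerm (Prod.map e id d) = Prod.map e id (M.facePerm d) := by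
      rintro ⟨w, k⟩
      simp [facePerm_apply, CubicMap.congr]
    have hpow : ∀ (n : ℕ) d, ((M.congr e).facePerm ^ n) (Prod.map e id d) =
        Prod.map e id ((M.facePerm ^ n) d) := by
      intro n d
      induction n with
      | zero => rfl
      | succ n ih => rw [pow_succ', pow_succ', Equiv.Perm.mul_apply, Equiv.Perm.mul_apply, ih, hface]
    have hd : ∀ d : W × Fin 3, d = Prod.map e id (Prod.map e.symm id d) := by
      rintro ⟨w, k⟩; simp
    have hd' : ∀ d : V × Fin 3, Prod.map e.symm id (Prod.map e id d) = d := by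
      rintro ⟨w, k⟩; simp
    refine ⟨L, hL, label ∘ Prod.map e.symm id, ?_, ?_, ?_, ?_⟩
    · exact h1.comp (Function.Surjective.prodMap e.symm.surjective Function.surjective_id)
    · intro d
      rw [hd d, hface, Function.comp_apply, Function.comp_apply, hd', hd', h2]
    · intro a b hab
      obtain ⟨n, hn⟩ := (h3 _ _ hab).exists_nat_pow_eq
      refine ⟨n, ?_⟩
      rw [zpow_natCast, hd a, hpow, hn, ← hd]
    · rw [h4, Nat.card_congr e]
  exists_crossing := by
    obtain ⟨d, hd⟩ := h.exists_crossing
    exact ⟨(e d.1, d.2), by simpa [CubicMap.congr] using hd⟩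
  cluster_le a := by
    refine le_trans (le_of_eq ?_) (h.cluster_le a)
    exact Equiv.sum_comp e.symm fun u => if π u = a then 1 + 2 * (f u + ∑ k, p u k) else 0
  le_cost S hS hcross := by
    refine (h.le_cost (S ∘ Prod.map e id) ⟨?_, ?_⟩ ?_).trans (le_of_eq ?_)
    · rintro ⟨w, k⟩
      rw [Function.comp_apply, Function.comp_apply, ← hS.1 (Prod.map e id (w, k))]
      congr 1
      simp [CubicMap.congr, Prod.map]
    · intro v
      exact hS.2 (e v)
    · obtain ⟨⟨w, k⟩, h1, h2⟩ := hcross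
      refine ⟨(e.symm w, k), by simpa using h1, ?_⟩
      simpa [CubicMap.congr] using h2
    · rw [← Equiv.sum_comp e]
      simp
  f_le u := h.f_le _

section Graph

variable {V : Type} (M : CubicMap V)

/-- The underlying simple graph of a cubic map. -/
def graph : SimpleGraph V where
  Adj u w := ∃ i, (M.flip (u, i)).1 = w
  symm := ⟨by
    rintro u _ ⟨i, rfl⟩
    exact ⟨(M.flip (u, i)).2, by rw [Prod.mk.eta, M.flip_flip]⟩⟩
  loopless := ⟨fun u ⟨i, hi⟩ => M.flip_ne (u, i) hi⟩

theorem graph_adj_flip (d : V × Fin 3) : M.graph.Adj d.1 (M.flip d).1 := ⟨d.2, rfl⟩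

theorem neighborSet_graph (u : V) :
    M.graph.neighborSet u = Set.range fun i => (M.flip (u, i)).1 := rfl

theorem isCubic_graph : IsCubic M.graph := by
  intro u
  rw [neighborSet_graph, Set.ncard_range_of_injective fun i j h => M.flip_inj u i j h]
  simp

/-- The darts of a cubic map are those of its underlying graph. -/
noncomputable def dartEquiv : V × Fin 3 ≃ M.graph.Dart :=
  Equiv.ofBijective (fun d => ⟨(d.1, (M.flip d).1), M.graph_adj_flip d⟩) <| by
    constructor
    · rintro ⟨u, i⟩ ⟨w, j⟩ h
      simp only [SimpleGraph.Dart.mk.injEq, Prod.mk.injEq] at h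
      obtain ⟨rfl, h⟩ := h
      rw [M.flip_inj u i j h]
    · rintro ⟨⟨u, w⟩, h⟩
      obtain ⟨i, hi⟩ := h
      exact ⟨(u, i), SimpleGraph.Dart.ext _ _ (Prod.ext rfl hi)⟩

theorem dartEquiv_fst (d : V × Fin 3) : (M.dartEquiv d).toProd.1 = d.1 := rfl

theorem dartEquiv_snd (d : V × Fin 3) : (M.dartEquiv d).toProd.2 = (M.flip d).1 := rfl

theorem dartEquiv_symm (d : V × Fin 3) : (M.dartEquiv d).symm = M.dartEquiv (M.flip d) := by
  ext
  · rfl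
  · simp [dartEquiv_snd, M.flip_flip, dartEquiv_fst]

/-- The rotation system of a cubic map, as an embedding of its underlying graph. -/
noncomputable def embedding : PlaneEmbedding M.graph where
  rot := M.dartEquiv.permCongr (rotation V)
  rot_tail d := by
    obtain ⟨d, rfl⟩ := M.dartEquiv.surjective d
    simp [dartEquiv_fst, rotation]
  rot_orbit d e h := by
    obtain ⟨⟨u, i⟩, rfl⟩ := M.dartEquiv.surjective d
    obtain ⟨⟨w, j⟩, rfl⟩ := M.dartEquiv.surjective e
    obtain rfl : u = w := h
    have step : ∀ k, (M.dartEquiv.permCongr (rotation V)) (M.dartEquiv (u, k)) =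
        M.dartEquiv (u, k + 1) := by
      intro k; simp [rotation]
    obtain rfl | rfl | rfl : j = i ∨ j = i + 1 ∨ j = i + 1 + 1 := by
      revert i j; decide
    · exact ⟨0, rfl⟩
    · exact ⟨1, by rw [pow_one, step]⟩
    · exact ⟨2, by rw [pow_two, Equiv.Perm.mul_apply, step, step]⟩

theorem embedding_facePerm : M.embedding.facePerm = M.dartEquiv.permCongrHom M.facePerm := by
  ext1 d
  obtain ⟨d, rfl⟩ := M.dartEquiv.surjective d
  change M.dartEquiv.permCongr (rotation V) (M.dartEquiv d).symm = _
  rw [dartEquiv_symm]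
  simp [facePerm_apply, rotation]
  rfl

theorem mem_faceOf_embedding (d e : V × Fin 3) :
    M.dartEquiv e ∈ M.embedding.faceOf (M.dartEquiv d) ↔ M.facePerm.SameCycle d e := by
  refine exists_congr fun n => ?_
  rw [embedding_facePerm, ← map_zpow]
  simp

variable {M}

theorem Spherical.isSpherical_embedding [Finite V] (h : M.Spherical) : M.embedding.IsSpherical := by
  classical
  obtain ⟨L, _, label, hsurj, hinv, hsame, hcard⟩ := h
  have := Fintype.ofFinite V
  have label_of_same : ∀ d e, M.facePerm.SameCycle d e → label d = label e := by
    intro d e hde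
    obtain ⟨n, rfl⟩ := hde.exists_nat_pow_eq
    induction n with
    | zero => rfl
    | succ n ih =>
      rw [pow_succ', Equiv.Perm.mul_apply, hinv]
      exact ih ⟨n, rfl⟩
  have hfaceOf : ∀ d, M.embedding.faceOf (M.dartEquiv d) =
      {e | label (M.dartEquiv.symm e) = label d} := by
    intro d
    ext e
    obtain ⟨e, rfl⟩ := M.dartEquiv.surjective e
    rw [mem_faceOf_embedding, Set.mem_ofPred_eq, Equiv.symm_apply_apply]
    exact ⟨fun h => (label_of_same d e h).symm, fun h => hsame d e h.symm⟩
  have hfaces : M.embedding.faces =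
      Set.range fun l : L => {e | label (M.dartEquiv.symm e) = l} := by
    ext s
    constructor
    · rintro ⟨d, rfl⟩
      obtain ⟨d, rfl⟩ := M.dartEquiv.surjective d
      exact ⟨label d, (hfaceOf d).symm⟩
    · rintro ⟨l, rfl⟩
      obtain ⟨d, rfl⟩ := hsurj l
      exact ⟨M.dartEquiv d, (hfaceOf d).symm⟩
  have hfcard : M.embedding.faces.ncard = Nat.card L := by
    rw [hfaces]
    refine Set.ncard_range_of_injective fun l l' h => ?_
    obtain ⟨d, rfl⟩ := hsurj l
    have : M.dartEquiv d ∈ {e | label (M.dartEquiv.symm e) = l'} := by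
      rw [← show _ = {e | label (M.dartEquiv.symm e) = l'} from h]
      simp
    simpa using this
  have hE : 3 * Nat.card V = 2 * M.graph.edgeSet.ncard := by
    have := M.graph.dart_card_eq_twice_card_edges
    rw [← Fintype.card_congr M.dartEquiv, Fintype.card_prod, Fintype.card_fin] at this
    rw [Nat.card_eq_fintype_card, mul_comm, this, ← SimpleGraph.coe_edgeFinset,
      Set.ncard_coe_finset]
  unfold PlaneEmbedding.IsSpherical
  rw [hfcard, Set.ncard_univ]
  omega

theorem ThreeConnected.iff_of_forall (h : M.ThreeConnected) [Finite V] (hV : 3 ≤ Nat.card V)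
    (P : V → Prop) (hP : ∀ u w, M.graph.Adj u w → (P u ↔ P w)) (u w : V) : P u ↔ P w := by
  obtain ⟨x, hx⟩ : ∃ x, x ∉ ({u, w} : Set V) := by
    by_contra! hx
    have : (Set.univ : Set V).ncard ≤ ({u, w} : Set V).ncard :=
      Set.ncard_le_ncard (fun x _ => hx x)
    rw [Set.ncard_univ] at this
    have := Set.ncard_insert_le u {w}
    rw [Set.ncard_singleton] at this
    omega
  simp only [Set.mem_insert_iff, Set.mem_singleton_iff, not_or] at hx
  exact h x x P (fun d _ _ _ _ => hP _ _ (M.graph_adj_flip d)) u w (Ne.symm hx.1) (Ne.symm hx.1)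
    (Ne.symm hx.2) (Ne.symm hx.2)

theorem ThreeConnected.connected_graph (h : M.ThreeConnected) [Finite V] (hV : 3 ≤ Nat.card V) :
    M.graph.Connected := by
  have : Nonempty V := (Nat.card_pos_iff.1 (by omega)).1
  refine ⟨fun u w => ?_⟩
  exact (h.iff_of_forall hV (fun z => M.graph.Reachable u z)
    (fun a b hab => ⟨fun hr => hr.trans hab.reachable, fun hr => hr.trans hab.symm.reachable⟩)
    u w).1 .rfl

theorem ThreeConnected.isThreeConnected_graph (h : M.ThreeConnected) [Finite V]
    (hV : 3 < Nat.card V) : IsThreeConnected M.graph := by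
  refine ⟨by rwa [Set.ncard_univ], fun s hs hcard => ?_⟩
  have hne : ∃ u, u ∉ s := by
    by_contra! hu
    have : s = Set.univ := Set.eq_univ_of_forall hu
    rw [this, Set.ncard_univ] at hcard
    omega
  obtain ⟨u₀, hu₀⟩ := hne
  have : Nonempty (sᶜ : Set V) := ⟨⟨u₀, hu₀⟩⟩
  refine ⟨fun a b => ?_⟩
  let P : V → Prop := fun z => ∃ hz : z ∈ sᶜ, (M.graph.induce sᶜ).Reachable a ⟨z, hz⟩
  have hP : ∀ u w, M.graph.Adj u w → u ∉ s → w ∉ s → (P u ↔ P w) := by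
    intro u w huw hu hw
    have : (M.graph.induce sᶜ).Adj ⟨u, hu⟩ ⟨w, hw⟩ := huw
    exact ⟨fun ⟨_, hr⟩ => ⟨hw, hr.trans this.reachable⟩,
      fun ⟨_, hr⟩ => ⟨hu, hr.trans this.symm.reachable⟩⟩
  have hPa : P a := ⟨a.2, .rfl⟩
  suffices P b from this.2
  have hcases : s = ∅ ∨ ∃ x y, s = {x, y} := by
    obtain h0 | h1 | h2 : s.ncard = 0 ∨ s.ncard = 1 ∨ s.ncard = 2 := by omega
    · exact Or.inl ((Set.ncard_eq_zero hs).1 h0)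
    · obtain ⟨x, rfl⟩ := Set.ncard_eq_one.1 h1
      exact Or.inr ⟨x, x, by simp⟩
    · obtain ⟨x, y, -, rfl⟩ := Set.ncard_eq_two.1 h2
      exact Or.inr ⟨x, y, rfl⟩
  obtain rfl | ⟨x, y, rfl⟩ := hcases
  · exact (h.iff_of_forall hV.le P (fun u w huw => hP u w huw (by simp) (by simp)) a b).1 hPa
  · have hmem : ∀ z, z ≠ x → z ≠ y → z ∉ ({x, y} : Set V) := by
      intro z h1 h2; simp [h1, h2]
    have ha := a.2
    have hb := b.2
    simp only [Set.mem_compl_iff, Set.mem_insert_iff, Set.mem_singleton_iff, not_or] at ha hb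
    refine (h x y P (fun d h1 h2 h3 h4 => ?_) a b ha.1 ha.2 hb.1 hb.2).1 hPa
    exact hP _ _ (M.graph_adj_flip d) (hmem _ h1 h2) (hmem _ h3 h4)

theorem ThreeConnected.exists_cycle (h : M.ThreeConnected) (d : V × Fin 3) :
    ∃ (v : V) (w : M.graph.Walk v v), w.IsCycle ∧ s(d.1, (M.flip d).1) ∈ w.edges := by
  obtain ⟨u, i⟩ := d
  refine (SimpleGraph.adj_and_reachable_delete_edges_iff_exists_cycle).1 ⟨M.graph_adj_flip _, ?_⟩
  set G' := M.graph \ SimpleGraph.fromEdgeSet {s(u, (M.flip (u, i)).1)}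
  have hadj : ∀ a b, M.graph.Adj a b → s(a, b) ≠ s(u, (M.flip (u, i)).1) → G'.Adj a b := by
    intro a b hab hne
    simp [G', hab, hne]
  have hx : G'.Reachable u (M.flip (u, i + 1)).1 := by
    refine (hadj _ _ (M.graph_adj_flip (u, i + 1)) fun h => ?_).reachable
    rw [Sym2.congr_right] at h
    exact (by decide : ∀ i : Fin 3, i + 1 ≠ i) i (M.flip_inj _ _ _ h)
  refine (h u u (fun z => G'.Reachable u z) (fun d h1 _ h3 _ => ?_) _ _ (M.flip_ne _) (M.flip_ne _)
    (M.flip_ne _) (M.flip_ne _)).1 hx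
  have := (hadj _ _ (M.graph_adj_flip d) fun h => ?_).reachable
  · exact ⟨fun hr => hr.trans this, fun hr => hr.trans this.symm⟩
  · rw [Sym2.eq_iff] at h
    exact h.elim (fun h => h1 h.1) (fun h => h3 h.2)

end Graph

end CubicMap

namespace CubicMap

section Cycles

variable {V : Type} {M : CubicMap V}

open scoped Classical in
/-- The darts of the edges of a walk. -/
noncomputable def walkDarts {v : V} (w : M.graph.Walk v v) (d : V × Fin 3) : Bool :=
  decide (s(d.1, (M.flip d).1) ∈ w.edges)

open scoped Classical in
theorem card_walkDarts {v : V} {w : M.graph.Walk v v} (hw : w.IsCycle) (u : V) :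
    (Finset.univ.filter fun i => walkDarts w (u, i) = true).card =
      if u ∈ w.support then 2 else 0 := by
  split_ifs with hu
  · rw [← hw.ncard_neighborSet_toSubgraph_eq_two hu, ← Set.ncard_coe_finset,
      ← Set.ncard_image_of_injective _ fun i j h => M.flip_inj u i j h]
    congr 1
    ext z
    simp only [walkDarts, Set.mem_image, Finset.coe_filter, Finset.mem_univ, true_and,
      decide_eq_true_eq, SimpleGraph.Subgraph.mem_neighborSet,
      SimpleGraph.Walk.adj_toSubgraph_iff_mem_edges]
    constructor
    · rintro ⟨i, hi, rfl⟩
      exact hi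
    · intro hz
      obtain ⟨i, rfl⟩ := w.adj_of_mem_edges hz
      exact ⟨i, hz, rfl⟩
  · rw [Finset.card_eq_zero, Finset.filter_eq_empty_iff]
    intro i _ hi
    exact hu (w.fst_mem_support_of_mem_edges (of_decide_eq_true hi))

theorem isEven_walkDarts {v : V} {w : M.graph.Walk v v} (hw : w.IsCycle) :
    M.IsEven (walkDarts w) := by
  classical
  refine ⟨fun d => ?_, fun u => ?_⟩
  · unfold walkDarts
    rw [M.flip_flip, Sym2.eq_swap]
  · have h : (Finset.univ.filter fun i => walkDarts w (u, i) = true).card = 0 ∨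
        (Finset.univ.filter fun i => walkDarts w (u, i) = true).card = 2 := by
      rw [card_walkDarts hw]
      split_ifs <;> simp
    generalize walkDarts w = S at h ⊢
    rw [Finset.card_filter, Fin.sum_univ_three] at h
    cases h0 : S (u, 0) <;> cases h1 : S (u, 1) <;> cases h2 : S (u, 2) <;> simp_all

open scoped Classical in
theorem card_support {v : V} {w : M.graph.Walk v v} (hw : w.IsCycle) :
    w.support.toFinset.card = w.length := by
  have : w.support.toFinset = w.support.tail.toFinset := by
    ext u
    rw [List.mem_toFinset, List.mem_toFinset]
    refine ⟨fun h => ?_, List.mem_of_mem_tail⟩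
    rw [SimpleGraph.Walk.mem_support_iff] at h
    exact h.elim (fun h => h ▸ w.end_mem_tail_support hw.not_nil) id
  rw [this, List.toFinset_card_of_nodup hw.support_nodup, List.length_tail, w.length_support]
  rfl

open scoped Classical in
theorem sum_walkDarts [Fintype V] {v : V} {w : M.graph.Walk v v} (hw : w.IsCycle) :
    ∑ u, ∑ k, (if walkDarts w (u, k) = true then 1 else 0) = 2 * w.length := by
  simp_rw [← Finset.card_filter, card_walkDarts hw]
  rw [← Finset.sum_filter, Finset.sum_const, ← card_support hw, smul_eq_mul, mul_comm]
  congr 2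
  ext u
  simp

variable [Fintype V] {r : ℕ} {H : Type} {π : V → H}

theorem Expandable.le_length (h : Expandable r M π (fun _ => 0) fun _ _ => 0) {v : V}
    {w : M.graph.Walk v v} (hw : w.IsCycle) {d : V × Fin 3} (hd : s(d.1, (M.flip d).1) ∈ w.edges)
    (hπ : π (M.flip d).1 ≠ π d.1) : 4 * r + 15 ≤ w.length := by
  classical
  have := h.le_cost (walkDarts w) (isEven_walkDarts hw) ⟨d, decide_eq_true hd, hπ⟩
  have h2 := sum_walkDarts hw
  simp only [mul_zero, add_zero] at this
  omega

theorem Expandable.length_le_or_le (h : Expandable r M π (fun _ => 0) fun _ _ => 0) {v : V}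
    {w : M.graph.Walk v v} (hw : w.IsCycle) : w.length ≤ 2 * r + 5 ∨ 4 * r + 15 ≤ w.length := by
  classical
  by_cases hc : ∃ d : V × Fin 3, s(d.1, (M.flip d).1) ∈ w.edges ∧ π (M.flip d).1 ≠ π d.1
  · obtain ⟨d, h1, h2⟩ := hc
    exact Or.inr (h.le_length hw h1 h2)
  · push Not at hc
    left
    have key : ∀ {a b : V} (q : M.graph.Walk a b), (∀ e ∈ q.edges, e ∈ w.edges) →
        ∀ u ∈ q.support, π u = π a := by
      intro a b q
      induction q with
      | nil => simp
      | @cons a b c hab q ih =>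
        intro hq u hu
        rw [SimpleGraph.Walk.support_cons, List.mem_cons] at hu
        obtain rfl | hu := hu
        · rfl
        · rw [ih (fun e he => hq e (by simp [he])) u hu]
          have hmem := hq s(a, b) (by simp)
          obtain ⟨i, rfl⟩ := hab
          exact hc (a, i) hmem
    have hsub : w.support.toFinset ⊆ Finset.univ.filter fun u => π u = π v := by
      intro u hu
      rw [List.mem_toFinset] at hu
      simpa using key w (fun _ => id) u hu
    have := Finset.card_le_card hsub
    have h2 := h.cluster_le (π v)
    rw [card_support hw, Finset.card_filter] at this
    simp only [Finset.sum_const_zero, mul_zero, add_zero] at h2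
    exact this.trans (le_trans (le_of_eq (Finset.sum_congr rfl fun _ _ => by congr)) h2)

theorem Expandable.exists_graph {r n : ℕ} {V H : Type} [Fintype V] {M : CubicMap V} {π : V → H}
    {f : V → ℕ} {p : V → Fin 3 → ℕ} (h : Expandable r M π f p) (hn : n < Fintype.card V)
    (h3 : 3 < Fintype.card V) :
    ∃ (m : ℕ) (G : SimpleGraph (Fin m)), n < m ∧
      IsThreeConnected G ∧ IsCubic G ∧ IsPlanar G ∧
      CircumferenceAtLeast G (2 * r + 6) ∧
      ∀ ℓ ∈ CycleLengths G, ¬(2 * r + 6 ≤ ℓ ∧ ℓ ≤ 4 * r + 14) := by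
  obtain ⟨W, _, N, ρ, hVW, hN⟩ := h.exists_expanded _ rfl
  have hM := hN.congr (Fintype.equivFin W)
  have hcard : 3 < Nat.card (Fin (Fintype.card W)) := by
    rw [Nat.card_eq_fintype_card, Fintype.card_fin]
    omega
  refine ⟨Fintype.card W, (N.congr (Fintype.equivFin W)).graph, by omega,
    hM.threeConnected.isThreeConnected_graph hcard, isCubic_graph _,
    ⟨hM.threeConnected.connected_graph hcard.le, _, hM.spherical.isSpherical_embedding⟩, ?_, ?_⟩
  · obtain ⟨d, hd⟩ := hM.exists_crossing
    obtain ⟨v, w, hw, hmem⟩ := hM.threeConnected.exists_cycle d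
    have := hM.le_length hw hmem hd
    exact ⟨w.length, ⟨v, w, hw, rfl⟩, by omega⟩
  · rintro _ ⟨v, w, hw, rfl⟩
    have := hM.length_le_or_le hw
    omega

end Cycles

end CubicMap

namespace CubicMap

namespace Drum

/-- A vertex of a column of the drum: an end of one of the four spokes of the column. -/
abbrev Cell : Type := Fin 4 × Bool

/-- The dart opposite to a dart of column `0`: the number of its column, its vertex in that column,
and its index. The dart `1` runs along a spoke, the others run along a ring. -/
def link : Cell × Fin 3 → ℤ × Cell × Fin 3
  | ((q, b), 1) => (0, (q, !b), 1)
  | ((q, false), 0) => if q = 0 then (1, (0, false), 2) else (1, (q - 1, true), 0)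
  | ((q, false), 2) => if q = 0 then (-1, (0, false), 0) else (0, (q - 1, true), 2)
  | ((q, true), 0) => if q = 3 then (-1, (3, true), 2) else (-1, (q + 1, false), 0)
  | ((q, true), 2) => if q = 3 then (1, (3, true), 0) else (0, (q + 1, false), 2)

theorem link_link : ∀ x, link (link x).2 = (-(link x).1, x) := by decide

theorem link_ne : ∀ x, (link x).2.1 = x.1 → (link x).1 ≠ 0 := by decide

theorem abs_link_le : ∀ x, |(link x).1| ≤ 1 := by decide

theorem link_inj : ∀ c i j, (link (c, i)).2.1 = (link (c, j)).2.1 →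
    (link (c, i)).1 = (link (c, j)).1 → i = j := by decide

theorem intCast_inj {N : ℕ} (hN : 3 ≤ N) {a b : ℤ} (ha : |a| ≤ 1) (hb : |b| ≤ 1)
    (h : (a : ZMod N) = b) : a = b := by
  rw [← sub_eq_zero, ← Int.cast_sub, ZMod.intCast_zmod_eq_zero_iff_dvd] at h
  rw [abs_le] at ha hb
  refine sub_eq_zero.1 (Int.eq_zero_of_abs_lt_dvd h ?_)
  rw [abs_lt]
  omega

end Drum

open Drum

/-- A cubic map of `N` columns with four spokes each, arranged in a cylinder: two `N`-gons
at the ends, next to each a ring of `N` pentagons, and two rings of `N` hexagons between them. -/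
def drum (N : ℕ) (hN : 3 ≤ N) : CubicMap (ZMod N × Cell) where
  flip d := ((d.1.1 + ((link (d.1.2, d.2)).1 : ZMod N), (link (d.1.2, d.2)).2.1),
    (link (d.1.2, d.2)).2.2)
  flip_flip := by
    rintro ⟨⟨i, c⟩, k⟩
    simp [link_link]
  flip_ne := by
    rintro ⟨⟨i, c⟩, k⟩ h
    simp only [Prod.mk.injEq, add_eq_left] at h
    refine link_ne (c, k) h.2 (intCast_inj hN (abs_link_le _) (by simp) ?_)
    rw [h.1, Int.cast_zero]
  flip_inj := by
    rintro ⟨i, c⟩ k l h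
    simp only [Prod.mk.injEq, add_right_inj] at h
    exact link_inj c k l h.2 (intCast_inj hN (abs_link_le _) (abs_link_le _) h.1)

namespace Drum

section Faces

/-- The successor of a dart of column `0` in its face. -/
def faceStep (x : Cell × Fin 3) : ℤ × Cell × Fin 3 :=
  ((link x).1, (link x).2.1, (link x).2.2 + 1)

/-- The face of a dart: the number of the column of the left one and the class of the two
spokes that it lies between, or one of the two ends of the drum. -/
def faceLabel : Cell × Fin 3 → ℤ × (Fin 4 ⊕ Fin 2)
  | ((q, false), 1) => (0, .inl q)
  | ((q, true), 2) => (0, .inl q)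
  | ((q, true), 1) => (-1, .inl q)
  | ((q, false), 2) => (-1, .inl q)
  | ((q, true), 0) => if q = 3 then (0, .inr 1) else (-1, .inl (q + 1))
  | ((q, false), 0) => if q = 0 then (0, .inr 0) else (0, .inl (q - 1))

theorem faceLabel_faceStep : ∀ x, (faceLabel (faceStep x).2).2 = (faceLabel x).2 ∧
    ((faceLabel x).2.isLeft = true →
      (faceStep x).1 + (faceLabel (faceStep x).2).1 = (faceLabel x).1) := by decide

theorem exists_iterate_faceStep : ∀ x q, (faceLabel x).2 = .inl q → ∃ n : Fin 6,
    (fun y : ℤ × Cell × Fin 3 => (y.1 + (faceStep y.2).1, (faceStep y.2).2))^[n]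
      (0, (q, false), 1) = (-(faceLabel x).1, x) := by decide

theorem eq_of_faceLabel_inr : ∀ x j, (faceLabel x).2 = .inr j →
    x = if j = 0 then ((0, false), 0) else ((3, true), 0) := by decide

variable {N : ℕ}

/-- The faces of the drum. -/
def label (d : (ZMod N × Cell) × Fin 3) : (ZMod N × Fin 4) ⊕ Fin 2 :=
  Sum.map (fun q => (d.1.1 + ((faceLabel (d.1.2, d.2)).1 : ZMod N), q)) id
    (faceLabel (d.1.2, d.2)).2

variable (hN : 3 ≤ N)

theorem drum_facePerm (i : ZMod N) (c : Cell) (k : Fin 3) :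
    (drum N hN).facePerm ((i, c), k) =
      ((i + ((faceStep (c, k)).1 : ZMod N), (faceStep (c, k)).2.1), (faceStep (c, k)).2.2) := rfl

theorem drum_facePerm_pow (n : ℕ) (i : ZMod N) (c : Cell) (k : Fin 3) (y : ℤ × Cell × Fin 3)
    (hy : (fun y : ℤ × Cell × Fin 3 => (y.1 + (faceStep y.2).1, (faceStep y.2).2))^[n] (0, c, k) =
      y) : ((drum N hN).facePerm ^ n) ((i, c), k) = ((i + (y.1 : ZMod N), y.2.1), y.2.2) := by
  induction n generalizing y with
  | zero => subst hy; simp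
  | succ n ih =>
    rw [Function.iterate_succ_apply'] at hy
    rw [pow_succ', Equiv.Perm.mul_apply, ih _ rfl, drum_facePerm, ← hy]
    simp [add_assoc]

theorem sameCycle_top (i j : ZMod N) :
    (drum N hN).facePerm.SameCycle ((i, 0, false), 0) ((j, 0, false), 0) := by
  have : NeZero N := ⟨by omega⟩
  have key : ∀ n : ℕ, ((drum N hN).facePerm ^ n) ((i, 0, false), 0) = ((i + n, 0, false), 0) := by
    intro n
    induction n with
    | zero => simp
    | succ n ih =>
      rw [pow_succ', Equiv.Perm.mul_apply, ih, drum_facePerm,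
        show faceStep ((0, false), 0) = (1, (0, false), 0) by decide]
      push_cast
      rw [add_assoc]
  refine ⟨((j - i).val : ℕ), ?_⟩
  rw [zpow_natCast, key, ZMod.natCast_zmod_val, add_sub_cancel]

theorem sameCycle_bottom (i j : ZMod N) :
    (drum N hN).facePerm.SameCycle ((i, 3, true), 0) ((j, 3, true), 0) := by
  have : NeZero N := ⟨by omega⟩
  have key : ∀ n : ℕ, ((drum N hN).facePerm ^ n) ((i, 3, true), 0) = ((i - n, 3, true), 0) := by
    intro n
    induction n with
    | zero => simp
    | succ n ih =>
      rw [pow_succ', Equiv.Perm.mul_apply, ih, drum_facePerm,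
        show faceStep ((3, true), 0) = (-1, (3, true), 0) by decide]
      push_cast
      rw [sub_add_eq_sub_sub, sub_eq_add_neg _ (1 : ZMod N)]
  refine ⟨((i - j).val : ℕ), ?_⟩
  rw [zpow_natCast, key, ZMod.natCast_zmod_val, sub_sub_cancel]

theorem sameCycle_of_label {i j : ZMod N} {c : Cell} {k : Fin 3} {q : Fin 4}
    (h : label ((i, c), k) = .inl (j, q)) :
    (drum N hN).facePerm.SameCycle ((j, q, false), 1) ((i, c), k) := by
  have hq : (faceLabel (c, k)).2 = .inl q ∧ i + ((faceLabel (c, k)).1 : ZMod N) = j := by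
    unfold label at h
    cases h' : (faceLabel (c, k)).2 <;> simp_all
  obtain ⟨n, hn⟩ := exists_iterate_faceStep (c, k) q hq.1
  refine ⟨(n : ℕ), ?_⟩
  rw [zpow_natCast, drum_facePerm_pow hN _ _ _ _ _ hn, ← hq.2]
  simp

theorem eq_of_label_inr {i : ZMod N} {c : Cell} {k : Fin 3} {j : Fin 2}
    (h : label ((i, c), k) = .inr j) :
    (c, k) = if j = 0 then ((0, false), 0) else ((3, true), 0) := by
  refine eq_of_faceLabel_inr _ _ ?_
  unfold label at h
  cases h' : (faceLabel (c, k)).2 <;> simp_all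

theorem spherical_drum : (drum N hN).Spherical := by
  have : NeZero N := ⟨by omega⟩
  refine ⟨(ZMod N × Fin 4) ⊕ Fin 2, inferInstance, label, ?_, ?_, ?_, ?_⟩
  · rintro (⟨j, q⟩ | j)
    · exact ⟨((j, q, false), 1), by simp [label, faceLabel]⟩
    · obtain rfl | rfl : j = 0 ∨ j = 1 := by revert j; decide
      · exact ⟨((0, 0, false), 0), by simp [label, faceLabel]⟩
      · exact ⟨((0, 3, true), 0), by simp [label, faceLabel]⟩
  · rintro ⟨⟨i, c⟩, k⟩
    rw [drum_facePerm]
    unfold label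
    obtain ⟨h1, h2⟩ := faceLabel_faceStep (c, k)
    simp only [Prod.mk.eta, h1]
    cases h' : (faceLabel (c, k)).2 with
    | inr j => rfl
    | inl q =>
      rw [← h2 (by rw [h']; rfl)]
      simp [add_assoc]
  · rintro ⟨⟨i, c⟩, k⟩ ⟨⟨i', c'⟩, k'⟩ h
    cases hl : label ((i, c), k) with
    | inl jq =>
      exact (sameCycle_of_label hN hl).symm.trans (sameCycle_of_label hN (h.symm.trans hl))
    | inr j =>
      have h1 := eq_of_label_inr hl
      have h2 := eq_of_label_inr (h.symm.trans hl)
      split_ifs at h1 h2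
      · obtain ⟨rfl, rfl⟩ := Prod.mk.inj h1
        obtain ⟨rfl, rfl⟩ := Prod.mk.inj h2
        exact sameCycle_top hN i i'
      · obtain ⟨rfl, rfl⟩ := Prod.mk.inj h1
        obtain ⟨rfl, rfl⟩ := Prod.mk.inj h2
        exact sameCycle_bottom hN i i'
  · simp only [Nat.card_eq_fintype_card, Fintype.card_sum, Fintype.card_prod, ZMod.card,
      Fintype.card_fin, Fintype.card_bool]
    omega

end Faces

end Drum

end CubicMap

namespace CubicMap

namespace Drum

section Rings

/-- The dart at a vertex that leads to its right neighbour on its ring. -/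
def right (c : Cell) : Fin 3 := if c.2 then 2 else 0

/-- The dart at a vertex that leads to its left neighbour on its ring. -/
def left (c : Cell) : Fin 3 := if c.2 then 0 else 2

/-- The ring of a vertex. -/
def ring (c : Cell) : Fin 5 := c.1.castSucc + (if c.2 then 1 else 0)

variable {N : ℕ}

/-- The right neighbour of a vertex on its ring. -/
def next (v : ZMod N × Cell) : ZMod N × Cell :=
  (v.1 + ((link (v.2, right v.2)).1 : ZMod N), (link (v.2, right v.2)).2.1)

/-- The other end of the spoke at a vertex. -/
def other (v : ZMod N × Cell) : ZMod N × Cell := (v.1, v.2.1, !v.2.2)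

theorem drum_flip_right (hN : 3 ≤ N) (v : ZMod N × Cell) :
    (drum N hN).flip (v, right v.2) = (next v, left (next v).2) := by
  obtain ⟨i, c⟩ := v
  have : (link (c, right c)).2.2 = left (link (c, right c)).2.1 := by revert c; decide
  simp [drum, next, this]

theorem drum_flip_spoke (hN : 3 ≤ N) (v : ZMod N × Cell) :
    (drum N hN).flip (v, 1) = (other v, 1) := by
  obtain ⟨i, q, b⟩ := v
  simp [drum, other, link]

theorem ring_next (v : ZMod N × Cell) : ring (next v).2 = ring v.2 := by
  obtain ⟨i, c⟩ := v
  change ring (link (c, right c)).2.1 = ring c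
  revert c; decide

theorem ring_iterate_next (v : ZMod N × Cell) (n : ℕ) : ring (next^[n] v).2 = ring v.2 := by
  induction n with
  | zero => rfl
  | succ n ih => rw [Function.iterate_succ_apply', ring_next, ih]

theorem ring_other_ne (v : ZMod N × Cell) : ring (other v).2 ≠ ring v.2 := by
  obtain ⟨i, c⟩ := v
  change ring (c.1, !c.2) ≠ ring c
  revert c; decide

theorem exists_iterate_next_add (i : ZMod N) (c : Cell) (n : ℕ) :
    ∃ m, n ≤ m ∧ next^[m] (i, c) = (i + n, c) := by
  induction n with
  | zero => exact ⟨0, le_rfl, by simp⟩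
  | succ n ih =>
    obtain ⟨m, hnm, hm⟩ := ih
    have : next (i + (n : ZMod N), c) = (i + ((n + 1 : ℕ) : ZMod N), c) ∨
        next (next (i + (n : ZMod N), c)) = (i + ((n + 1 : ℕ) : ZMod N), c) := by
      have hc : link (c, right c) = (1, c, left c) ∨ (link (c, right c)).1 +
          (link ((link (c, right c)).2.1, right (link (c, right c)).2.1)).1 = 1 ∧
          (link ((link (c, right c)).2.1, right (link (c, right c)).2.1)).2.1 = c := by
        clear hm
        revert c; decide
      obtain h | ⟨h1, h2⟩ := hc
      · left
        simp [next, h, add_assoc]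
      · right
        simp [next, h2, add_assoc, ← Int.cast_add, h1]
    obtain h | h := this
    · exact ⟨m + 1, by omega, by rw [Function.iterate_succ_apply', hm, h]⟩
    · exact ⟨m + 2, by omega, by
        rw [Function.iterate_succ_apply', Function.iterate_succ_apply', hm, h]⟩

theorem exists_iterate_next [NeZero N] (v w : ZMod N × Cell) (h : ring v.2 = ring w.2) :
    ∃ n, next^[n] v = w := by
  obtain ⟨i, c⟩ := v
  obtain ⟨j, c'⟩ := w
  have shift : ∀ i j : ZMod N, ∀ c, ∃ n, next^[n] (i, c) = (j, c) := by
    intro i j c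
    obtain ⟨m, -, hm⟩ := exists_iterate_next_add i c (j - i).val
    exact ⟨m, by rw [hm, ZMod.natCast_zmod_val, add_sub_cancel]⟩
  have hc : c = c' ∨ (link (c, right c)).2.1 = c' := by
    change ring c = ring c' at h
    revert c c'; decide
  obtain rfl | hc := hc
  · exact shift i j c
  · obtain ⟨n, hn⟩ := shift (next (i, c)).1 j c'
    refine ⟨n + 1, ?_⟩
    rw [Function.iterate_succ_apply, ← hn, ← hc]
    rfl

theorem exists_iterate_succ_next [NeZero N] (v : ZMod N × Cell) : ∃ n, next (next^[n] v) = v := by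
  obtain ⟨m, hNm, hm⟩ := exists_iterate_next_add v.1 v.2 N
  obtain ⟨n, rfl⟩ : ∃ n, m = n + 1 := ⟨m - 1, by have := NeZero.pos N; omega⟩
  refine ⟨n, ?_⟩
  rw [← Function.iterate_succ_apply' next]
  simpa using hm

theorem ring_induction [NeZero N] {P : ZMod N × Cell → Prop} {v : ZMod N × Cell} (hv : P v)
    (hP : ∀ w, ring w.2 = ring v.2 → P w → P (next w)) (w : ZMod N × Cell)
    (hw : ring w.2 = ring v.2) : P w := by
  obtain ⟨n, rfl⟩ := exists_iterate_next v w hw.symm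
  clear hw
  induction n with
  | zero => exact hv
  | succ n ih =>
    rw [Function.iterate_succ_apply']
    exact hP _ (ring_iterate_next v n) ih

end Rings

section Connectivity

variable {N : ℕ}

theorem exists_column (hN : 3 ≤ N) (i j : ZMod N) : ∃ l, l ≠ i ∧ l ≠ j := by
  have : NeZero N := ⟨by omega⟩
  by_contra! h
  have : (Finset.univ : Finset (ZMod N)) ⊆ {i, j} := by
    intro l _
    by_cases hl : l = i
    · simp [hl]
    · simp [h l hl]
  have := (Finset.card_le_card this).trans Finset.card_le_two
  rw [Finset.card_univ, ZMod.card] at this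
  omega

theorem threeConnected_drum (hN : 3 ≤ N) : (drum N hN).ThreeConnected := by
  have : NeZero N := ⟨by omega⟩
  intro x y P hP
  obtain ⟨l, hlx, hly⟩ := exists_column hN x.1 y.1
  have hright : ∀ v : ZMod N × Cell, v ≠ x → v ≠ y → next v ≠ x → next v ≠ y →
      (P v ↔ P (next v)) := by
    intro v
    have := hP (v, right v.2)
    rwa [drum_flip_right] at this
  have hspoke : ∀ v : ZMod N × Cell, v ≠ x → v ≠ y → other v ≠ x → other v ≠ y →
      (P v ↔ P (other v)) := by
    intro v
    have := hP (v, 1)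
    rwa [drum_flip_spoke] at this
  have hl : ∀ c : Cell, ((l, c) : ZMod N × Cell) ≠ x ∧ ((l, c) : ZMod N × Cell) ≠ y :=
    fun c => ⟨fun h => hlx (congrArg Prod.fst h), fun h => hly (congrArg Prod.fst h)⟩
  have hcol : ∀ c : Cell, P (l, c) ↔ P (l, 0, false) := by
    have h1 : ∀ q : Fin 4, P (l, q, true) ↔ P (l, q, false) := fun q =>
      hspoke (l, q, true) (hl _).1 (hl _).2 (hl _).1 (hl _).2
    have h2 : ∀ q : Fin 4, q ≠ 3 → (P (l, q, true) ↔ P (l, q + 1, false)) := by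
      intro q hq
      have hnext : next (l, q, true) = (l, q + 1, false) := by
        simp [next, link, right, hq]
      have := hright (l, q, true) (hl _).1 (hl _).2
      rw [hnext] at this
      exact this (hl _).1 (hl _).2
    have h3 := h2 0 (by decide)
    have h4 := h2 1 (by decide)
    have h5 := h2 2 (by decide)
    have hq : ∀ q : Fin 4, P (l, q, false) ↔ P (l, 0, false) := by
      intro q
      have := h1 0
      have := h1 1
      have := h1 2
      simp only [zero_add, show (1 : Fin 4) + 1 = 2 by decide,
        show (2 : Fin 4) + 1 = 3 by decide] at h3 h4 h5
      fin_cases q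
      · exact Iff.rfl
      · change P (l, 1, false) ↔ _
        tauto
      · change P (l, 2, false) ↔ _
        tauto
      · change P (l, 3, false) ↔ _
        tauto
    rintro ⟨q, _ | _⟩
    · exact hq q
    · exact (h1 q).trans (hq q)
  have hring : ∀ z : ZMod N × Cell, z ≠ x → z ≠ y →
      ¬(x ≠ y ∧ ring x.2 = ring z.2 ∧ ring y.2 = ring z.2) → (P z ↔ P (l, 0, false)) := by
    intro z hzx hzy hxy
    obtain ⟨a, haz, ha⟩ : ∃ a : ZMod N × Cell, ring a.2 = ring z.2 ∧
        ∀ w, ring w.2 = ring z.2 → w = x ∨ w = y → next w = a := by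
      by_cases hx : ring x.2 = ring z.2
      · refine ⟨next x, by rw [ring_next, hx], ?_⟩
        rintro w hw (rfl | rfl)
        · rfl
        · by_contra h
          exact hxy ⟨fun h' => h (by rw [h']), hx, hw⟩
      · by_cases hy : ring y.2 = ring z.2
        · refine ⟨next y, by rw [ring_next, hy], ?_⟩
          rintro w hw (rfl | rfl)
          · exact absurd hw hx
          · rfl
        · refine ⟨z, rfl, ?_⟩
          rintro w hw (rfl | rfl)
          · exact absurd hw hx
          · exact absurd hw hy
    have key : ∀ w : ZMod N × Cell, ring w.2 = ring a.2 →
        (w ≠ x → w ≠ y → (P w ↔ P a)) := by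
      refine ring_induction (fun _ _ => Iff.rfl) fun w hw ih h1 h2 => ?_
      by_cases hwx : w = x ∨ w = y
      · rw [ha w (hw.trans haz) hwx]
      · rw [not_or] at hwx
        rw [← ih hwx.1 hwx.2]
        exact (hright w hwx.1 hwx.2 h1 h2).symm
    obtain ⟨c, hc⟩ : ∃ c : Cell, ring c = ring a.2 := ⟨a.2, rfl⟩
    rw [key z haz.symm hzx hzy, ← hcol c]
    exact (key (l, c) hc (hl c).1 (hl c).2).symm
  have main : ∀ z : ZMod N × Cell, z ≠ x → z ≠ y → (P z ↔ P (l, 0, false)) := by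
    intro z hzx hzy
    by_cases h : x ≠ y ∧ ring x.2 = ring z.2 ∧ ring y.2 = ring z.2
    · have hox : other z ≠ x := fun h' => ring_other_ne z (by rw [h', h.2.1])
      have hoy : other z ≠ y := fun h' => ring_other_ne z (by rw [h', h.2.2])
      rw [hspoke z hzx hzy hox hoy]
      exact hring _ hox hoy fun h' => ring_other_ne z (by rw [← h'.2.1, h.2.1])
    · exact hring z hzx hzy h
  intro u w h1 h2 h3 h4
  rw [main u h1 h2, main w h3 h4]

end Connectivity

end Drum

end CubicMap

namespace CubicMap

namespace Drum

section Cost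

/-- The exceptional vertices of a column, at which a unit of weight is moved from the spoke to the
dart to the right. -/
def special (c : Cell) : Bool := c == (1, false) || c == (2, true)

/-- The weights of the darts of the drum. -/
def weight (r : ℕ) (c : Cell) (k : Fin 3) : ℕ :=
  if k = 1 then (if special c then r else r + 1) else if special c ∧ k = right c then 1 else 0

theorem sum_weight (r : ℕ) (c : Cell) : ∑ k, weight r c k = r + 1 := by
  rw [Fin.sum_univ_three]
  obtain ⟨q, _ | _⟩ := c
  · cases h : special (q, false) <;> simp [weight, right, h, add_comm]
  · cases h : special (q, true) <;> simp [weight, right, h, add_comm]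

variable {N : ℕ}

/-- The cost of a set of darts at a vertex. -/
def cost (r : ℕ) (S : (ZMod N × Cell) × Fin 3 → Bool) (v : ZMod N × Cell) : ℕ :=
  ∑ k, if S (v, k) = true then 1 + 1 + 2 * weight r v.2 k else 0

variable {hN : 3 ≤ N} {r : ℕ} {S : (ZMod N × Cell) × Fin 3 → Bool}

theorem even_left (hS : (drum N hN).IsEven S) (v : ZMod N × Cell) :
    S (next v, left (next v).2) = S (v, right v.2) := by
  rw [← hS.1 (v, right v.2), drum_flip_right]

theorem even_other (hS : (drum N hN).IsEven S) (v : ZMod N × Cell) :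
    S (other v, 1) = S (v, 1) := by
  rw [← hS.1 (v, 1), drum_flip_spoke]

theorem even_right (hS : (drum N hN).IsEven S) (v : ZMod N × Cell) :
    S (v, right v.2) = (S (v, left v.2) ^^ S (v, 1)) := by
  have := hS.2 v
  obtain ⟨i, q, b⟩ := v
  revert this
  cases b <;> simp only [right, left] <;> simp only [Bool.false_eq_true, if_true, if_false] <;>
    generalize S ((i, q, _), 0) = s₀ <;> generalize S ((i, q, _), 1) = s₁ <;>
    generalize S ((i, q, _), 2) = s₂ <;> revert s₀ s₁ s₂ <;> decide

theorem le_cost_of_spoke (hS : (drum N hN).IsEven S) {v : ZMod N × Cell} (hv : S (v, 1) = true) :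
    2 * r + 6 ≤ cost r S v + (if special v.2 ∧ S (v, right v.2) = false then 2 else 0) := by
  have := hS.2 v
  obtain ⟨i, q, b⟩ := v
  unfold cost
  rw [Fin.sum_univ_three]
  cases b <;> cases h : special (q, _) <;> cases h0 : S ((i, q, _), 0) <;>
    cases h2 : S ((i, q, _), 2) <;> simp_all [weight, right] <;> omega

theorem le_cost_of_not_spoke (hS : (drum N hN).IsEven S) {v : ZMod N × Cell}
    (hv : S (v, 1) = false) (hR : S (v, right v.2) = true) :
    4 + (if special v.2 then 2 else 0) ≤ cost r S v := by
  have := hS.2 v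
  obtain ⟨i, q, b⟩ := v
  unfold cost
  rw [Fin.sum_univ_three]
  cases b <;> cases h : special (q, _) <;> cases h0 : S ((i, q, _), 0) <;>
    cases h2 : S ((i, q, _), 2) <;> simp_all [weight, right]

theorem exists_turn [NeZero N] (hS : (drum N hN).IsEven S) {v : ZMod N × Cell}
    (hv : S (v, 1) = true) :
    ∃ w, ring w.2 = ring v.2 ∧ S (w, 1) = true ∧ S (w, right w.2) = !S (v, right v.2) := by
  by_contra! h
  have key : ∀ w, ring w.2 = ring v.2 → S (w, right w.2) = S (v, right v.2) := by
    refine ring_induction rfl fun w hw ih => ?_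
    cases hs : S (next w, 1) with
    | true =>
      have := h (next w) ((ring_next w).trans hw) hs
      simpa using this
    | false => rw [even_right hS, even_left hS, ih, hs, Bool.xor_false]
  obtain ⟨n, hn⟩ := exists_iterate_succ_next v
  have h1 := key _ (ring_iterate_next v n)
  have h2 := even_left hS (next^[n] v)
  have h3 := even_right hS v
  rw [hn] at h2
  rw [h2, h1, hv] at h3
  simp at h3

theorem le_sum_cost_of_three [NeZero N] (hS : (drum N hN).IsEven S) {u v w : ZMod N × Cell}
    (hu : S (u, 1) = true) (hv : S (v, 1) = true) (hw : S (w, 1) = true)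
    (huv : (u.1, u.2.1) ≠ (v.1, v.2.1)) (huw : (u.1, u.2.1) ≠ (w.1, w.2.1))
    (hvw : (v.1, v.2.1) ≠ (w.1, w.2.1)) : 12 * r + 30 ≤ ∑ u, cost r S u := by
  have hspoke : ∀ v : ZMod N × Cell, S (v, 1) = true →
      4 * r + 10 ≤ cost r S (v.1, v.2.1, true) + cost r S (v.1, v.2.1, false) := by
    have : ∀ i : ZMod N, ∀ q : Fin 4, S ((i, q, false), 1) = true →
        4 * r + 10 ≤ cost r S (i, q, true) + cost r S (i, q, false) := by
      intro i q h
      have h1 := le_cost_of_spoke (r := r) hS h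
      have h2 := le_cost_of_spoke (r := r) hS ((even_other hS (i, q, false)).trans h)
      have h3 : ¬(special (q, false) = true ∧ special (q, true) = true) := by
        clear h1 h2 h
        revert q; decide
      simp only [other, Bool.not_false] at h1 h2
      split_ifs at h1 h2 <;> first | omega | simp_all
    rintro ⟨i, q, _ | _⟩ h
    · exact this i q h
    · exact this i q ((even_other hS (i, q, true)).trans h)
  have hsum : ∑ u, cost r S u =
      ∑ e : ZMod N × Fin 4, (cost r S (e.1, e.2, true) + cost r S (e.1, e.2, false)) := by
    simp only [Fintype.sum_prod_type, Fintype.sum_bool]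
  rw [hsum]
  refine le_trans ?_ (Finset.sum_le_sum_of_subset
    (Finset.subset_univ {(u.1, u.2.1), (v.1, v.2.1), (w.1, w.2.1)}))
  rw [Finset.sum_insert (by simp only [Finset.mem_insert, Finset.mem_singleton]; tauto),
    Finset.sum_insert (by simp only [Finset.mem_singleton]; tauto), Finset.sum_singleton]
  have h1 := hspoke u hu
  have h2 := hspoke v hv
  have h3 := hspoke w hw
  dsimp only
  omega

theorem le_sum_cost_of_no_spoke [NeZero N] (hS : (drum N hN).IsEven S)
    (hno : ∀ v, S (v, 1) = false) {d : (ZMod N × Cell) × Fin 3} (hd : S d = true) :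
    4 * N ≤ ∑ u, cost r S u := by
  obtain ⟨v, k⟩ := d
  have hR : S (v, right v.2) = true := by
    have h := even_right hS v
    rw [hno, Bool.xor_false] at h
    obtain rfl | rfl | rfl : k = 1 ∨ k = right v.2 ∨ k = left v.2 := by
      have : ∀ b : Bool, ∀ k : Fin 3, k = 1 ∨ k = (if b = true then 2 else 0) ∨
          k = if b = true then 0 else 2 := by decide
      exact this v.2.2 k
    · rw [hno] at hd
      exact absurd hd (by decide)
    · exact hd
    · rw [h, hd]
  have key : ∀ w, ring w.2 = ring v.2 → S (w, right w.2) = true := by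
    refine ring_induction hR fun w hw ih => ?_
    rw [even_right hS, even_left hS, ih, hno, Bool.xor_false]
  rw [Fintype.sum_prod_type_right]
  refine le_trans ?_ (Finset.single_le_sum (fun _ _ => Nat.zero_le _) (Finset.mem_univ v.2))
  have : ∀ i ∈ (Finset.univ : Finset (ZMod N)), 4 ≤ cost r S (i, v.2) := fun i _ =>
    le_trans (Nat.le_add_right _ _) (le_cost_of_not_spoke hS (hno _) (key (i, v.2) rfl))
  have := Finset.card_nsmul_le_sum _ _ _ this
  rw [Finset.card_univ, ZMod.card, smul_eq_mul] at this
  omega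

theorem le_sum_cost_of_spoke [NeZero N] (hS : (drum N hN).IsEven S) {v : ZMod N × Cell}
    (hv : S (v, 1) = true) : 8 * r + 30 ≤ ∑ u, cost r S u := by
  by_contra! hlt
  obtain ⟨i, q, hi⟩ : ∃ i q, S ((i, q, false), 1) = true := by
    obtain ⟨i, q, _ | _⟩ := v
    · exact ⟨i, q, hv⟩
    · exact ⟨i, q, (even_other hS (i, q, true)).trans hv⟩
  have hi' : S ((i, q, true), 1) = true := (even_other hS (i, q, false)).trans hi
  obtain ⟨v₁, hr₁, hs₁, hR₁⟩ := exists_turn hS hi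
  obtain ⟨v₂, hr₂, hs₂, hR₂⟩ := exists_turn hS hi'
  have hring : ∀ (q : Fin 4) (b b' : Bool), ring (q, b') = ring (q, b) → b' = b := by decide
  have hne : ∀ b, ∀ w : ZMod N × Cell, ring w.2 = ring (q, b) →
      S (w, right w.2) = (!S ((i, q, b), right (q, b))) → (i, q) ≠ (w.1, w.2.1) := by
    rintro b ⟨j, q', b'⟩ hr hR h
    obtain ⟨rfl, rfl⟩ := Prod.mk.inj h
    obtain rfl : b' = b := hring q b b' hr
    simp at hR
  have hne₁ := hne _ _ hr₁ hR₁
  have hne₂ := hne _ _ hr₂ hR₂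
  have h12 : (v₁.1, v₁.2.1) = (v₂.1, v₂.2.1) := by
    by_contra h
    have := le_sum_cost_of_three (r := r) hS hi hs₁ hs₂ hne₁ hne₂ h
    omega
  obtain ⟨j, q₁, b₁⟩ := v₁
  obtain ⟨j₂, q₂, b₂⟩ := v₂
  obtain ⟨rfl, rfl⟩ : j = j₂ ∧ q₁ = q₂ := Prod.mk.inj h12
  obtain ⟨rfl, rfl, rfl⟩ : q = q₁ ∧ b₁ = false ∧ b₂ = true := by
    have : ∀ (q q₁ : Fin 4) (b₁ b₂ : Bool), ring (q₁, b₁) = ring (q, false) →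
        ring (q₁, b₂) = ring (q, true) → q = q₁ ∧ b₁ = false ∧ b₂ = true := by decide
    exact this q q₁ b₁ b₂ hr₁ hr₂
  have hij : i ≠ j := fun h => hne₁ (by rw [h])
  have honly : ∀ w : ZMod N × Cell, w.2.1 ≠ q → S (w, 1) = false := by
    intro w hw
    by_contra h
    rw [Bool.not_eq_false] at h
    have := le_sum_cost_of_three (r := r) hS hi hs₁ h hne₁
      (fun h => hw (congrArg Prod.snd h).symm) fun h => hw (congrArg Prod.snd h).symm
    omega
  have hpair : ∀ b, S ((i, q, b), 1) = true → S ((j, q, b), 1) = true →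
      S ((j, q, b), right (q, b)) = (!S ((i, q, b), right (q, b))) →
      4 * r + 12 ≤ ∑ l, cost r S (l, q, b) + if special (q, b) then 2 else 0 := by
    intro b h1 h2 h3
    have h4 := le_cost_of_spoke (r := r) hS h1
    have h5 := le_cost_of_spoke (r := r) hS h2
    have h6 : cost r S (i, q, b) + cost r S (j, q, b) ≤ ∑ l, cost r S (l, q, b) :=
      Finset.add_le_sum (f := fun l => cost r S (l, q, b)) (fun _ _ => Nat.zero_le _) (Finset.mem_univ i) (Finset.mem_univ j) hij
    dsimp only at h4 h5
    rw [h3] at h5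
    cases h7 : S ((i, q, b), right (q, b)) <;> cases h8 : special (q, b) <;>
      simp [h7, h8] at h4 h5 ⊢ <;> omega
  have hnext : ∀ b c, S ((j, q, b), right (q, b)) = (!S ((i, q, b), right (q, b))) →
      (link ((q, b), right (q, b))).2.1 = c → c.1 ≠ q →
      4 + (if special c then 2 else 0) ≤ ∑ l, cost r S (l, c) := by
    intro b c h1 h2 h3
    obtain ⟨l, hl⟩ : ∃ l, S ((l, q, b), right (q, b)) = true := by
      cases h : S ((i, q, b), right (q, b)) with
      | true => exact ⟨i, h⟩
      | false => exact ⟨j, by rw [h1, h]; rfl⟩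
    have hc : (next (l, q, b)).2 = c := h2
    have hno : S (next (l, q, b), 1) = false := honly _ (by rw [hc]; exact h3)
    have hR : S (next (l, q, b), right (next (l, q, b)).2) = true := by
      rw [even_right hS, even_left hS, hl, hno]
      rfl
    have h4 := le_cost_of_not_spoke (r := r) hS hno hR
    rw [hc] at h4
    refine h4.trans ?_
    rw [← hc]
    exact Finset.single_le_sum (f := fun l' => cost r S (l', (next (l, q, b)).2))
      (fun _ _ => Nat.zero_le _) (Finset.mem_univ (next (l, q, b)).1)
  have hf := hpair false hi hs₁ hR₁
  have ht := hpair true hi' hs₂ hR₂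
  have hnf := fun c => hnext false c hR₁
  have hnt := fun c => hnext true c hR₂
  clear hpair hnext honly hij hne₁ hne₂ h12 hr₁ hr₂ hR₁ hR₂ hs₁ hs₂ hi hi' hne
  rw [Fintype.sum_prod_type_right] at hlt
  simp only [Fintype.sum_prod_type, Fintype.sum_bool, Fin.sum_univ_four] at hlt
  obtain rfl | rfl | rfl | rfl : q = 0 ∨ q = 1 ∨ q = 2 ∨ q = 3 := by
    clear hf ht hnf hnt
    revert q; decide
  · have := hnt (1, false) (by decide) (by decide)
    simp [special] at *
    omega
  · have := hnf (0, true) (by decide) (by decide)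
    have := hnt (2, false) (by decide) (by decide)
    simp [special] at *
    omega
  · have := hnf (1, true) (by decide) (by decide)
    have := hnt (3, false) (by decide) (by decide)
    simp [special] at *
    omega
  · have := hnf (2, true) (by decide) (by decide)
    simp [special] at *
    omega

theorem expandable_drum {r N : ℕ} [NeZero N] (hN : 3 ≤ N) (hr : 2 * r + 8 ≤ N) :
    Expandable r (drum N hN) id (fun _ => 1) (fun v => weight r v.2) where
  threeConnected := threeConnected_drum hN
  spherical := spherical_drum hN
  exists_crossing := ⟨((0, 0, false), 0), (drum N hN).flip_ne _⟩
  cluster_le v := by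
    simp only [id_eq, sum_weight, Finset.sum_ite_eq', Finset.mem_univ, if_true]
    omega
  le_cost S hS := by
    rintro ⟨d, hd, -⟩
    change _ ≤ ∑ u, cost r S u
    by_cases hno : ∀ v, S (v, 1) = false
    · exact le_trans (by omega) (le_sum_cost_of_no_spoke hS hno hd)
    · push Not at hno
      obtain ⟨v, hv⟩ := hno
      exact le_sum_cost_of_spoke hS (by simpa using hv)
  f_le _ := le_rfl

end Cost

end Drum

end CubicMap

/-- For every `r ≥ 0` and every `n`, there is a 3-connected cubic planar graph
on more than `n` vertices of circumference at least `2r+6` with no cycle of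
length `ℓ` for any `2r+6 ≤ ℓ ≤ 4r+14`. -/
theorem statement9 (r n : ℕ) :
    ∃ (m : ℕ) (G : SimpleGraph (Fin m)), n < m ∧
      IsThreeConnected G ∧ IsCubic G ∧ IsPlanar G ∧
      CircumferenceAtLeast G (2 * r + 6) ∧
      ∀ ℓ ∈ CycleLengths G, ¬(2 * r + 6 ≤ ℓ ∧ ℓ ≤ 4 * r + 14) := by
  have : NeZero (2 * r + 8 + n) := ⟨by omega⟩
  have hcard : Fintype.card (ZMod (2 * r + 8 + n) × CubicMap.Drum.Cell) = (2 * r + 8 + n) * 8 := by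
    rw [Fintype.card_prod, ZMod.card]
    rfl
  exact (CubicMap.Drum.expandable_drum (r := r) (N := 2 * r + 8 + n) (by omega)
    (by omega)).exists_graph (by omega) (by omega)
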